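/- arXiv:1003.4421 — 2 statements merged into one kernel-verified Lean document; each statement's English description precedes it below -/
import Mathlib

section
/- Let q = p^e with p > 3 prime and q ≡ 1 (mod 12). Let E: y² = x³ + ax + b be an elliptic curve over F_q with j(E) ≠ 0, 1728 (equivalently a ≠ 0 and b ≠ 0 with nonzero discriminant), and T a generator of the character group of F_q^*. Then the number of affine F_q-points satisfies #{(x,y) ∈ F_q²: y² = x³+ax+b} = q + T^{(q-1)/4}(a³/27) · q · ₂F₁(T^{(q-1)/12}, T^{5(q-1)/12}; T^{(q-1)/2} | -27b²/(4a³))_q, where ₂F₁ is Greene's Gaussian hypergeometric series over F_q. -/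
open Finset

/-- The canonical additive character `θ(α) = e^{2πi·tr(α)/p}` of `F = F_q`, `q = p^e`. -/
noncomputable def theta (p : ℕ) (F : Type) [Field F] [Fintype F] [Algebra (ZMod p) F]
    (α : F) : ℂ :=
  Complex.exp (2 * Real.pi * Complex.I * ((Algebra.trace (ZMod p) F α).val : ℂ) / p)

/-- The Gauss sum `G_m = ∑_{x ∈ F_q} T^m(x) θ(x)` (recall `T^m (0) = 0` for `T^m` nontrivial,
and characters are extended by `χ(0) = 0`). -/
noncomputable def gaussT (p : ℕ) (F : Type) [Field F] [Fintype F] [Algebra (ZMod p) F]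
    (T : MulChar F ℂ) (m : ℤ) : ℂ :=
  ∑ x : F, (T ^ m) x * theta p F x

/-- The normalized Jacobi sum `binom(A,B) = (B(-1)/q) · J(A, B̄)`. -/
noncomputable def binomC (F : Type) [Field F] [Fintype F] (A B : MulChar F ℂ) : ℂ :=
  B (-1) / (Fintype.card F : ℂ) * jacobiSum A B⁻¹

/-- Greene's Gaussian hypergeometric series `₂F₁(A,B;C|x)_q`, the sum over all
multiplicative characters `χ = T^m` of `F_q^*`, written via a generator `T` of the
character group. -/
noncomputable def hypF21 (F : Type) [Field F] [Fintype F] (T : MulChar F ℂ)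
    (A B C : MulChar F ℂ) (x : F) : ℂ :=
  (Fintype.card F : ℂ) / ((Fintype.card F : ℂ) - 1) *
    ∑ m ∈ Finset.range (Fintype.card F - 1),
      binomC F (A * T ^ m) (T ^ m) * binomC F (B * T ^ m) (C * T ^ m) * (T ^ m) x


theorem MulChar.isCyclic_complex (F : Type*) [Field F] [Fintype F] : IsCyclic (MulChar F ℂ) :=
  (MulChar.mulEquiv_units F ℂ).some.isCyclic.mpr inferInstance

theorem MulChar.card_complex (F : Type*) [Field F] [Fintype F] [Fintype (MulChar F ℂ)] :
    Fintype.card (MulChar F ℂ) = Fintype.card F - 1 := by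
  classical
  rw [← Fintype.card_units, ← Nat.card_eq_fintype_card, ← Nat.card_eq_fintype_card]
  exact MulChar.card_eq_card_units_of_hasEnoughRootsOfUnity F ℂ

theorem MulChar.sum_apply_eq_ite {F : Type*} [Field F] [Fintype F] [Fintype (MulChar F ℂ)]
    [DecidableEq F] (a : F) :
    ∑ χ : MulChar F ℂ, χ a = if a = 1 then (Fintype.card F : ℂ) - 1 else 0 := by
  split_ifs with h
  · subst h
    simp [MulChar.card_complex, Nat.cast_sub Fintype.card_pos]
  · obtain ⟨χ, hχ⟩ := MulChar.exists_apply_ne_one_of_hasEnoughRootsOfUnity F ℂ h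
    refine eq_zero_of_mul_eq_self_left hχ ?_
    simp only [Finset.mul_sum, ← MulChar.mul_apply]
    exact Fintype.sum_bijective _ (Group.mulLeft_bijective χ) _ _ fun _ => rfl

theorem MulChar.sum_mul_sum_inv {F : Type*} [Field F] [Fintype F] [Fintype (MulChar F ℂ)]
    (f : F → ℂ) {c : F} (hc : c ≠ 0) :
    ∑ χ : MulChar F ℂ, χ c * ∑ d, χ⁻¹ d * f d = ((Fintype.card F : ℂ) - 1) * f c := by
  classical
  simp only [Finset.mul_sum]
  rw [Finset.sum_comm]
  have h (d : F) : ∑ χ : MulChar F ℂ, χ c * (χ⁻¹ d * f d) =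
      if d = c then ((Fintype.card F : ℂ) - 1) * f d else 0 := by
    have (χ : MulChar F ℂ) : χ c * (χ⁻¹ d * f d) = χ (c * d⁻¹) * f d := by
      rw [MulChar.inv_apply', map_mul, mul_assoc]
    simp only [this]
    rw [← Finset.sum_mul, MulChar.sum_apply_eq_ite]
    have : c * d⁻¹ = 1 ↔ d = c := by
      rcases eq_or_ne d 0 with rfl | hd
      · simpa using hc.symm
      · rw [mul_inv_eq_one₀ hd, eq_comm]
    simp only [this, ite_mul, zero_mul]
  simp [h]

theorem MulChar.pow_three_eq_one_iff {F : Type*} [Field F] [Fintype F] {ω : MulChar F ℂ}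
    (hω : ω ≠ 1) (hω3 : ω ^ 3 = 1) (χ : MulChar F ℂ) :
    χ ^ 3 = 1 ↔ χ = 1 ∨ χ = ω ∨ χ = ω ^ 2 := by
  classical
  let _ := Fintype.ofFinite (MulChar F ℂ)
  have := MulChar.isCyclic_complex F
  constructor
  · intro h
    have hle := IsCyclic.card_pow_eq_one_le (α := MulChar F ℂ) (n := 3) (by norm_num)
    have hsub : ({1, ω, ω ^ 2} : Finset (MulChar F ℂ)) ⊆ ({a | a ^ 3 = 1} : Finset _) := by
      intro a ha
      simp only [mem_insert, mem_singleton] at ha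
      rcases ha with h | h | h <;> simp [h, hω3, ← pow_mul, mul_comm 2 3, pow_mul ω 3 2]
    have hc : ({1, ω, ω ^ 2} : Finset (MulChar F ℂ)).card = 3 := by
      rw [Finset.card_eq_three]
      refine ⟨1, ω, ω ^ 2, hω.symm, ?_, ?_, rfl⟩
      · intro h2
        exact hω (by rw [← hω3, pow_succ, ← h2, one_mul])
      · intro h2
        exact hω (by rwa [pow_two, left_eq_mul] at h2)
    have := Finset.eq_of_subset_of_card_le hsub (by omega)
    have hm : χ ∈ ({1, ω, ω ^ 2} : Finset (MulChar F ℂ)) := by rw [this]; simpa using h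
    simpa using hm
  · rintro (rfl | rfl | rfl)
    · simp
    · exact hω3
    · rw [← pow_mul, mul_comm, pow_mul, hω3, one_pow]

theorem MulChar.card_pow_three_eq_one {F : Type*} [Field F] [Fintype F] [Fintype (MulChar F ℂ)]
    [DecidableEq (MulChar F ℂ)] {ω : MulChar F ℂ} (hω : ω ≠ 1) (hω3 : ω ^ 3 = 1) :
    (univ.filter fun χ : MulChar F ℂ => χ ^ 3 = 1).card = 3 := by
  rw [Finset.card_eq_three]
  refine ⟨1, ω, ω ^ 2, hω.symm, ?_, ?_, ?_⟩
  · intro h2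
    exact hω (by rw [← hω3, pow_succ, ← h2, one_mul])
  · intro h2
    exact hω (by rwa [pow_two, left_eq_mul] at h2)
  · ext χ
    simp [MulChar.pow_three_eq_one_iff hω hω3]

theorem norm_gaussSum_sq {F : Type*} [Field F] [Fintype F] {χ : MulChar F ℂ} (hχ : χ ≠ 1)
    {θ : AddChar F ℂ} (hθ : θ.IsPrimitive) : ‖gaussSum χ θ‖ ^ 2 = Fintype.card F := by
  have h := gaussSum_mul_gaussSum_eq_card hχ hθ
  rw [← star_gaussSum_eq, RCLike.star_def, Complex.mul_conj'] at h
  exact_mod_cast h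

theorem AddChar.IsPrimitive.ne_one' {F : Type*} [Field F] {θ : AddChar F ℂ}
    (hθ : θ.IsPrimitive) : θ ≠ 1 := by
  simpa using hθ one_ne_zero

theorem norm_gaussSum_mul_mul_sq {F : Type*} [Field F] [Fintype F] {ω : MulChar F ℂ}
    (hω : ω ≠ 1) (hω3 : ω ^ 3 = 1) {θ : AddChar F ℂ} (hθ : θ.IsPrimitive) (χ : MulChar F ℂ) :
    ‖gaussSum χ θ * gaussSum (χ * ω) θ * gaussSum (χ * ω ^ 2) θ‖ ^ 2 =
      (Fintype.card F : ℝ) ^ 2 * ‖gaussSum (χ ^ 3) θ‖ ^ 2 := by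
  have hω2 : ω ^ 2 ≠ 1 := fun h => hω (by rw [← hω3, pow_succ, h, one_mul])
  have h4 : ω * ω ^ 2 = 1 := by rw [← pow_succ', hω3]
  have h5 : ω ^ 2 * ω = 1 := by rw [← pow_succ, hω3]
  have h6 : ω ^ 2 * ω ^ 2 = ω := by rw [← pow_add, pow_succ, hω3, one_mul]
  simp only [norm_mul, mul_pow]
  by_cases h : χ ^ 3 = 1
  · rw [h, gaussSum_one_left hθ.ne_one']
    rcases (MulChar.pow_three_eq_one_iff hω hω3 χ).mp h with rfl | rfl | rfl
    · rw [one_mul, one_mul, gaussSum_one_left hθ.ne_one', norm_gaussSum_sq hω hθ,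
        norm_gaussSum_sq hω2 hθ]
      norm_num; ring
    · rw [h4, ← pow_two, gaussSum_one_left hθ.ne_one', norm_gaussSum_sq hω hθ,
        norm_gaussSum_sq hω2 hθ]
      norm_num; ring
    · rw [h5, h6, gaussSum_one_left hθ.ne_one', norm_gaussSum_sq hω hθ,
        norm_gaussSum_sq hω2 hθ]
      norm_num; ring
  · have hn : ¬(χ = 1 ∨ χ = ω ∨ χ = ω ^ 2) := by
      rwa [← MulChar.pow_three_eq_one_iff hω hω3]
    push Not at hn
    have h1 : χ * ω ≠ 1 := fun h' => hn.2.2 (by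
      rw [← mul_one χ, ← h4, ← mul_assoc, h', one_mul])
    have h2 : χ * ω ^ 2 ≠ 1 := fun h' => hn.2.1 (by
      rw [← mul_one χ, ← h5, ← mul_assoc, h', one_mul])
    rw [norm_gaussSum_sq hn.1 hθ, norm_gaussSum_sq h1 hθ, norm_gaussSum_sq h2 hθ,
      norm_gaussSum_sq h hθ]
    ring

theorem sum_norm_gaussSum_pow_three {F : Type*} [Field F] [Fintype F] [Fintype (MulChar F ℂ)]
    {ω : MulChar F ℂ} (hω : ω ≠ 1) (hω3 : ω ^ 3 = 1) {θ : AddChar F ℂ} (hθ : θ.IsPrimitive) :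
    ∑ χ : MulChar F ℂ, ‖gaussSum (χ ^ 3) θ‖ ^ 2 =
      ((Fintype.card F : ℝ) - 1) * ((Fintype.card F : ℝ) - 3) := by
  classical
  have h (χ : MulChar F ℂ) : ‖gaussSum (χ ^ 3) θ‖ ^ 2 =
      (Fintype.card F : ℝ) - if χ ^ 3 = 1 then (Fintype.card F : ℝ) - 1 else 0 := by
    split_ifs with h
    · simp [h, gaussSum_one_left hθ.ne_one']
    · simp [norm_gaussSum_sq h hθ]
  simp only [h]
  rw [Finset.sum_sub_distrib, ← Finset.sum_filter, Finset.sum_const, Finset.sum_const,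
    MulChar.card_pow_three_eq_one hω hω3, Finset.card_univ, MulChar.card_complex, nsmul_eq_mul, nsmul_eq_mul,
    Nat.cast_sub Fintype.card_pos]
  push_cast
  ring

theorem card_cubic_param {F : Type*} [Field F] [Fintype F] [DecidableEq F] (h3 : (3 : F) ≠ 0)
    {ζ : F} (hζ : ζ ^ 2 + ζ + 1 = 0) :
    ((univ.filter fun t : F => t ≠ 0 ∧ t + 1 ≠ 0 ∧ t ^ 2 + t + 1 ≠ 0).card : ℂ) =
      (Fintype.card F : ℂ) - 4 := by
  have hroot (t : F) : t ^ 2 + t + 1 = 0 ↔ t = ζ ∨ t = -1 - ζ := by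
    rw [← sub_eq_zero (a := t) (b := ζ), ← sub_eq_zero (a := t) (b := -1 - ζ), ← mul_eq_zero]
    constructor <;> intro h
    · linear_combination h - hζ
    · linear_combination h + hζ
  have hne : ζ ≠ -1 - ζ := fun h => h3 (by linear_combination 4 * hζ - (2 * ζ + 1) * h)
  have h0 : ζ ≠ 0 := by rintro rfl; simp at hζ
  have h1 : ζ ≠ -1 := by rintro rfl; simp at hζ
  have hcompl : (univ.filter fun t : F => t ≠ 0 ∧ t + 1 ≠ 0 ∧ t ^ 2 + t + 1 ≠ 0) =
      ({0, -1, ζ, -1 - ζ} : Finset F)ᶜ := by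
    ext t
    simp only [mem_filter, mem_univ, true_and, ne_eq, hroot, mem_compl, mem_insert, mem_singleton,
      not_or, ← eq_neg_iff_add_eq_zero]
  have hcard : ({0, -1, ζ, -1 - ζ} : Finset F).card = 4 := by
    rw [card_insert_of_notMem, card_insert_of_notMem, card_insert_of_notMem, card_singleton]
    · simpa using hne
    · simp only [mem_insert, mem_singleton, not_or]
      exact ⟨h1.symm, fun h => h0 (by linear_combination h)⟩
    · simp only [mem_insert, mem_singleton, not_or]
      exact ⟨by simp, h0.symm, fun h => h1 (by linear_combination h)⟩
  rw [hcompl, card_compl, hcard, Nat.cast_sub]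
  · simp
  · rw [← hcard]; exact card_le_univ _

theorem card_nodal_cubic {F : Type*} [Field F] [Fintype F] [DecidableEq F] (h3 : (3 : F) ≠ 0)
    {ζ : F} (hζ : ζ ^ 2 + ζ + 1 = 0) :
    ((univ.filter fun v : F × F => v.1 * v.2 * (3 - v.1 - v.2) = 1).card : ℂ) =
      (Fintype.card F : ℂ) - 3 := by
  have hmem : ((1, 1) : F × F) ∈
      univ.filter fun v : F × F => v.1 * v.2 * (3 - v.1 - v.2) = 1 := by
    simp only [mem_filter, mem_univ, true_and]; ring
  have hnode (y z : F) (hne : ¬(y = 1 ∧ z = 1)) (h : y * z * (3 - y - z) = 1) :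
      y - 1 ≠ 0 ∧ z - 1 ≠ 0 ∧ y - 1 + (z - 1) ≠ 0 := by
    have hy : y - 1 ≠ 0 := by
      intro hy
      obtain rfl := sub_eq_zero.mp hy
      have : (z - 1) ^ 2 = 0 := by linear_combination -h
      exact hne ⟨rfl, sub_eq_zero.mp (pow_eq_zero_iff two_ne_zero |>.mp this)⟩
    refine ⟨hy, fun hz => ?_, fun hyz => ?_⟩
    · obtain rfl := sub_eq_zero.mp hz
      have : (y - 1) ^ 2 = 0 := by linear_combination -h
      exact hy (pow_eq_zero_iff two_ne_zero |>.mp this)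
    · have : (y - 1) ^ 2 = 0 := by linear_combination -h + (y - y * z) * hyz
      exact hy (pow_eq_zero_iff two_ne_zero |>.mp this)
  rw [← card_erase_add_one hmem]
  have : ((univ.filter fun v : F × F => v.1 * v.2 * (3 - v.1 - v.2) = 1).erase (1, 1)).card =
      (univ.filter fun t : F => t ≠ 0 ∧ t + 1 ≠ 0 ∧ t ^ 2 + t + 1 ≠ 0).card := by
    refine card_nbij' (fun v => (v.1 - 1) / (v.2 - 1))
      (fun t => (-t ^ 2 / (t + 1), -1 / (t * (t + 1)))) ?_ ?_ ?_ ?_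
    all_goals
      simp only [Set.MapsTo, Set.LeftInvOn, mem_coe, mem_erase, mem_filter, mem_univ, true_and,
        Prod.forall, ne_eq, Prod.mk.injEq]
    · rintro y z ⟨hne, h⟩
      obtain ⟨hy, hz, hyz⟩ := hnode y z hne h
      refine ⟨div_ne_zero hy hz, fun h' => ?_, fun h' => ?_⟩
      · rw [div_add_one hz, div_eq_zero_iff] at h'
        exact h'.elim hyz hz
      · field_simp at h'
        have : (y - 1) * (z - 1) * (y - 1 + (z - 1)) = 0 := by
          linear_combination -h - h'
        simp [hy, hz, hyz] at this
    · rintro t ⟨h0, h1, h2⟩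
      refine ⟨fun h => h2 ?_, ?_⟩
      · have := h.2
        field_simp at this
        linear_combination -this
      · field_simp
        ring
    · rintro y z ⟨hne, h⟩
      obtain ⟨hy, hz, hyz⟩ := hnode y z hne h
      have ht : (y - 1) / (z - 1) + 1 = (y - 1 + (z - 1)) / (z - 1) := by field_simp
      rw [ht]
      constructor
      · field_simp
        linear_combination h
      · field_simp
        linear_combination h
    · rintro t ⟨h0, h1, h2⟩
      have : -1 / (t * (t + 1)) - 1 = -(t ^ 2 + t + 1) / (t * (t + 1)) := by
        field_simp; ring
      rw [this]
      have h2' : -(t ^ 2 + t + 1) ≠ 0 := neg_ne_zero.mpr h2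
      rw [div_eq_iff (by positivity)]
      field_simp
      ring
  rw [this]
  push_cast
  rw [card_cubic_param h3 hζ]
  ring

theorem inv_mul_inv_mul_inv_eq {G : Type*} [CommGroup G] (a : G) {b : G} (hb : b ^ 3 = 1) :
    a⁻¹ * (a * b)⁻¹ * (a * b ^ 2)⁻¹ = (a ^ 3)⁻¹ := by
  rw [← mul_inv, ← mul_inv]
  calc (a * (a * b) * (a * b ^ 2))⁻¹ = (a ^ 3 * b ^ 3)⁻¹ := by
        simp only [pow_succ, pow_zero, one_mul]; ac_rfl
    _ = _ := by rw [hb, mul_one]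

theorem MulChar.apply_pow_eq_one {F : Type*} [Field F] {χ : MulChar F ℂ} {n : ℕ} (h : χ ^ n = 1)
    {x : F} (hx : x ≠ 0) : χ x ^ n = 1 := by
  lift x to Fˣ using isUnit_iff_ne_zero.mpr hx
  rw [← MulChar.pow_apply_coe, h, MulChar.one_apply_coe]

theorem MulChar.apply_mul_apply_sq_nodal_cubic {F : Type*} [Field F] {ω : MulChar F ℂ}
    (hω3 : ω ^ 3 = 1) {y z : F} (h : y * z * (3 - y - z) = 1) : ω y * (ω ^ 2) z = 1 := by
  have hy : y ≠ 0 := by rintro rfl; simp at h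
  have hz : z ≠ 0 := by rintro rfl; simp at h
  have hcube : y * (z - 1) ^ 3 = z * (y - 1) ^ 3 := by linear_combination (y - z) * h
  rw [MulChar.pow_apply' ω two_ne_zero]
  rcases eq_or_ne y 1 with rfl | hy1
  · have : (z - 1) ^ 3 = 0 := by linear_combination hcube
    obtain rfl := sub_eq_zero.mp (pow_eq_zero_iff three_ne_zero |>.mp this)
    simp
  · have hy' := sub_ne_zero.mpr hy1
    have hz' : z - 1 ≠ 0 := by
      intro hz'
      rw [hz', zero_pow three_ne_zero, mul_zero] at hcube
      exact mul_ne_zero hz (pow_ne_zero 3 hy') hcube.symm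
    have := congrArg ω hcube
    rw [map_mul, map_mul, map_pow, map_pow, MulChar.apply_pow_eq_one hω3 hy',
      MulChar.apply_pow_eq_one hω3 hz', mul_one, mul_one] at this
    rw [this, ← pow_succ', MulChar.apply_pow_eq_one hω3 hz]

theorem sum_nodal_cubic {F : Type*} [Field F] [Fintype F] [DecidableEq F] (h3 : (3 : F) ≠ 0)
    {ζ : F} (hζ : ζ ^ 2 + ζ + 1 = 0) {ω : MulChar F ℂ} (hω3 : ω ^ 3 = 1) :
    ∑ y, ∑ z, (ω y * (ω ^ 2) z) * (if (y * z)⁻¹ + y + z - 3 = 0 then (1 : ℂ) else 0) =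
      (Fintype.card F : ℂ) - 3 := by
  rw [← card_nodal_cubic h3 hζ, ← Fintype.sum_prod_type'
    (f := fun y z => (ω y * (ω ^ 2) z) * (if (y * z)⁻¹ + y + z - 3 = 0 then (1 : ℂ) else 0)),
    Finset.card_filter]
  push_cast
  refine Finset.sum_congr rfl fun v _ => ?_
  obtain ⟨y, z⟩ := v
  by_cases h0 : y * z = 0
  · simp only [h0, zero_mul, zero_ne_one, if_false]
    rcases mul_eq_zero.mp h0 with rfl | rfl <;> simp [MulChar.map_zero]
  · have : (y * z)⁻¹ + y + z - 3 = 0 ↔ y * z * (3 - y - z) = 1 := by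
      rw [← mul_right_inj' h0, mul_zero]
      have e : y * z * ((y * z)⁻¹ + y + z - 3) = 1 - y * z * (3 - y - z) := by
        rw [mul_sub, mul_add, mul_add, mul_inv_cancel₀ h0]; ring
      rw [e, sub_eq_zero, eq_comm]
    simp only [this]
    split_ifs with h
    · rw [mul_one, MulChar.apply_mul_apply_sq_nodal_cubic hω3 h]
    · simp

theorem sum_gaussSum_mul_mul {F : Type*} [Field F] [Fintype F] [Fintype (MulChar F ℂ)]
    (ω : MulChar F ℂ) (θ : AddChar F ℂ) :
    ∑ χ : MulChar F ℂ, gaussSum χ θ * gaussSum (χ * ω) θ * gaussSum (χ * ω ^ 2) θ =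
      ((Fintype.card F : ℂ) - 1) *
        ∑ y, ∑ z, (ω y * (ω ^ 2) z) * θ ((y * z)⁻¹ + y + z) := by
  classical
  have h (χ : MulChar F ℂ) : gaussSum χ θ * gaussSum (χ * ω) θ * gaussSum (χ * ω ^ 2) θ =
      ∑ y, ∑ z, ∑ x, (ω y * (ω ^ 2) z) * θ (x + y + z) * χ (x * (y * z)) := by
    simp only [gaussSum, Finset.mul_sum, Finset.sum_mul, MulChar.mul_apply]
    rw [Finset.sum_comm]
    refine Finset.sum_congr rfl fun y _ => Finset.sum_congr rfl fun z _ =>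
      Finset.sum_congr rfl fun x _ => ?_
    simp only [map_mul, AddChar.map_add_eq_mul]
    ring
  simp only [h]
  rw [Finset.sum_comm, Finset.mul_sum]
  refine Finset.sum_congr rfl fun y _ => ?_
  rw [Finset.sum_comm, Finset.mul_sum]
  refine Finset.sum_congr rfl fun z _ => ?_
  rw [Finset.sum_comm]
  simp only [← Finset.mul_sum, MulChar.sum_apply_eq_ite]
  by_cases h0 : y * z = 0
  · simp only [h0, mul_zero, zero_ne_one, if_false, Finset.sum_const_zero]
    rcases mul_eq_zero.mp h0 with rfl | rfl <;> simp [MulChar.map_zero]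
  · simp only [mul_eq_one_iff_eq_inv₀ h0, mul_ite, mul_zero, Finset.sum_ite_eq', mem_univ, if_true]
    ring

theorem sum_gaussSum_mul_star {F : Type*} [Field F] [Fintype F] [Fintype (MulChar F ℂ)]
    (h3 : (3 : F) ≠ 0) {ζ : F} (hζ : ζ ^ 2 + ζ + 1 = 0) {ω : MulChar F ℂ}
    (hω : ω ≠ 1) (hω3 : ω ^ 3 = 1) {θ : AddChar F ℂ} (hθ : θ.IsPrimitive) :
    ∑ χ : MulChar F ℂ, gaussSum χ θ * gaussSum (χ * ω) θ * gaussSum (χ * ω ^ 2) θ *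
        star (gaussSum (χ ^ 3) (θ.mulShift 3)) =
      (Fintype.card F : ℂ) * ((Fintype.card F : ℂ) - 1) * ((Fintype.card F : ℂ) - 3) := by
  classical
  have hmul (w : F) (χ : MulChar F ℂ) :
      gaussSum χ θ * gaussSum (χ * ω) θ * gaussSum (χ * ω ^ 2) θ *
        ((χ ^ 3)⁻¹ w * (θ.mulShift 3)⁻¹ w) =
      if w = 0 then 0 else θ (-3 * w) * (gaussSum χ (θ.mulShift w) *
        gaussSum (χ * ω) (θ.mulShift w) * gaussSum (χ * ω ^ 2) (θ.mulShift w)) := by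
    split_ifs with hw
    · simp [hw, MulChar.map_zero]
    · lift w to Fˣ using isUnit_iff_ne_zero.mpr hw
      have e : χ⁻¹ w * (χ * ω)⁻¹ w * (χ * ω ^ 2)⁻¹ w = (χ ^ 3)⁻¹ (w : F) := by
        rw [← MulChar.mul_apply, ← MulChar.mul_apply]
        congr 2
        exact inv_mul_inv_mul_inv_eq χ hω3
      simp only [gaussSum_mulShift_eq, ← e, AddChar.inv_apply, AddChar.mulShift_apply]
      rw [mul_neg, neg_mul]
      ring
  have hstar (χ : MulChar F ℂ) : star (gaussSum (χ ^ 3) (θ.mulShift 3)) =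
      ∑ w, (χ ^ 3)⁻¹ w * (θ.mulShift 3)⁻¹ w := by rw [star_gaussSum_eq, gaussSum]
  simp only [hstar, Finset.mul_sum, hmul]
  rw [Finset.sum_comm]
  have hw (w : F) : ∑ χ : MulChar F ℂ, (if w = 0 then 0 else θ (-3 * w) *
        (gaussSum χ (θ.mulShift w) *
        gaussSum (χ * ω) (θ.mulShift w) * gaussSum (χ * ω ^ 2) (θ.mulShift w))) =
      ((Fintype.card F : ℂ) - 1) * ∑ y, ∑ z, (ω y * (ω ^ 2) z) *
        (θ (w * ((y * z)⁻¹ + y + z - 3)) - if w = 0 then 1 else 0) := by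
    split_ifs with h
    · simp [h]
    · rw [← Finset.mul_sum, sum_gaussSum_mul_mul, mul_left_comm]
      congr 1
      simp only [Finset.mul_sum]
      refine Finset.sum_congr rfl fun y _ => Finset.sum_congr rfl fun z _ => ?_
      rw [AddChar.mulShift_apply, mul_left_comm, ← AddChar.map_add_eq_mul, sub_zero]
      congr 2
      ring
  simp only [hw]
  rw [← Finset.mul_sum, Finset.sum_comm]
  have hyz (y z : F) : ∑ w, (ω y * (ω ^ 2) z) *
      (θ (w * ((y * z)⁻¹ + y + z - 3)) - if w = 0 then 1 else 0) =
      (Fintype.card F : ℂ) * ((ω y * (ω ^ 2) z) *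
        if (y * z)⁻¹ + y + z - 3 = 0 then (1 : ℂ) else 0) - ω y * (ω ^ 2) z := by
    rw [← Finset.mul_sum, Finset.sum_sub_distrib, AddChar.sum_mulShift _ hθ]
    simp only [Finset.sum_ite_eq', mem_univ, if_true]
    split_ifs <;> push_cast <;> ring
  have hcomm (y : F) : ∑ w, ∑ z, (ω y * (ω ^ 2) z) *
      (θ (w * ((y * z)⁻¹ + y + z - 3)) - if w = 0 then 1 else 0) =
      ∑ z, ((Fintype.card F : ℂ) * ((ω y * (ω ^ 2) z) *
        if (y * z)⁻¹ + y + z - 3 = 0 then (1 : ℂ) else 0) - ω y * (ω ^ 2) z) := by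
    rw [Finset.sum_comm]
    simp only [hyz]
  simp only [hcomm, Finset.sum_sub_distrib, ← Finset.mul_sum]
  rw [sum_nodal_cubic h3 hζ hω3, ← Finset.sum_mul, MulChar.sum_eq_zero_of_ne_one hω]
  ring

/-- The Davenport–Hasse product relation for characters of order three. -/
theorem gaussSum_mul_mul_eq {F : Type*} [Field F] [Fintype F]
    (h3 : (3 : F) ≠ 0) {ζ : F} (hζ : ζ ^ 2 + ζ + 1 = 0) {ω : MulChar F ℂ}
    (hω : ω ≠ 1) (hω3 : ω ^ 3 = 1) {θ : AddChar F ℂ} (hθ : θ.IsPrimitive) (χ : MulChar F ℂ) :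
    gaussSum χ θ * gaussSum (χ * ω) θ * gaussSum (χ * ω ^ 2) θ =
      (Fintype.card F : ℂ) * (χ⁻¹ 27 * gaussSum (χ ^ 3) θ) := by
  classical
  let _ := Fintype.ofFinite (MulChar F ℂ)
  set P : MulChar F ℂ → ℂ :=
    fun χ => gaussSum χ θ * gaussSum (χ * ω) θ * gaussSum (χ * ω ^ 2) θ with hP
  set Q : MulChar F ℂ → ℂ :=
    fun χ => (Fintype.card F : ℂ) * gaussSum (χ ^ 3) (θ.mulShift 3) with hQ
  have hQ' (χ : MulChar F ℂ) : Q χ = (Fintype.card F : ℂ) * (χ⁻¹ 27 * gaussSum (χ ^ 3) θ) := by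
    have := gaussSum_mulShift_eq (χ ^ 3) θ (Units.mk0 3 h3)
    rw [Units.val_mk0] at this
    rw [hQ]
    simp only
    rw [this, ← inv_pow, MulChar.pow_apply' _ three_ne_zero, ← map_pow]
    norm_num
  have hPn (χ) : ‖P χ‖ ^ 2 = (Fintype.card F : ℝ) ^ 2 * ‖gaussSum (χ ^ 3) θ‖ ^ 2 :=
    norm_gaussSum_mul_mul_sq hω hω3 hθ χ
  have h27 : (27 : F) ≠ 0 := by
    rw [show (27 : F) = 3 ^ 3 by norm_num]; exact pow_ne_zero 3 h3
  have hQn (χ) : ‖Q χ‖ ^ 2 = (Fintype.card F : ℝ) ^ 2 * ‖gaussSum (χ ^ 3) θ‖ ^ 2 := by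
    have hu : ‖χ⁻¹ (27 : F)‖ = 1 := by
      have : χ⁻¹ (27 : F) ^ Nat.card Fˣ = 1 := by
        rw [Nat.card_eq_fintype_card, Fintype.card_units, ← map_pow,
          FiniteField.pow_card_sub_one_eq_one _ h27, map_one]
      exact Complex.norm_eq_one_of_pow_eq_one this Nat.card_pos.ne'
    rw [hQ', norm_mul, norm_mul, hu, one_mul, mul_pow, Complex.norm_natCast]
  have hPQ : ∑ χ, P χ * star (Q χ) = (Fintype.card F : ℂ) *
      ((Fintype.card F : ℂ) * ((Fintype.card F : ℂ) - 1) * ((Fintype.card F : ℂ) - 3)) := by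
    rw [← sum_gaussSum_mul_star h3 hζ hω hω3 hθ, Finset.mul_sum]
    refine Finset.sum_congr rfl fun χ _ => ?_
    simp only [hP, hQ, star_mul, RCLike.star_def, Complex.conj_natCast]
    ring
  have hre : ∑ χ, (P χ * star (Q χ)).re = (Fintype.card F : ℝ) ^ 2 *
      (((Fintype.card F : ℝ) - 1) * ((Fintype.card F : ℝ) - 3)) := by
    rw [← Complex.re_sum, hPQ]
    have : (Fintype.card F : ℂ) *
      ((Fintype.card F : ℂ) * ((Fintype.card F : ℂ) - 1) * ((Fintype.card F : ℂ) - 3)) =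
      (((Fintype.card F : ℝ) ^ 2 * (((Fintype.card F : ℝ) - 1) * ((Fintype.card F : ℝ) - 3)) : ℝ) :
        ℂ) := by push_cast; ring
    rw [this, Complex.ofReal_re]
  have hsum : ∑ χ, ‖P χ - Q χ‖ ^ 2 = 0 := by
    have hexp (χ) : ‖P χ - Q χ‖ ^ 2 = ‖P χ‖ ^ 2 + ‖Q χ‖ ^ 2 - 2 * (P χ * star (Q χ)).re := by
      simp only [← Complex.normSq_eq_norm_sq]
      exact Complex.normSq_sub _ _
    simp only [hexp, hPn, hQn]
    rw [Finset.sum_sub_distrib, Finset.sum_add_distrib, ← Finset.mul_sum, ← Finset.mul_sum, hre,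
      sum_norm_gaussSum_pow_three hω hω3 hθ]
    ring
  have := (Finset.sum_eq_zero_iff_of_nonneg fun χ _ => sq_nonneg ‖P χ - Q χ‖).mp hsum χ (mem_univ χ)
  rw [pow_eq_zero_iff two_ne_zero, norm_eq_zero, sub_eq_zero] at this
  rw [← hQ', ← this]

theorem MulChar.eq_of_sq_eq_one {F : Type*} [Field F] [Fintype F] {φ φ' : MulChar F ℂ}
    (hφ : φ ≠ 1) (hφ2 : φ ^ 2 = 1) (hφ' : φ' ≠ 1) (hφ2' : φ' ^ 2 = 1) : φ = φ' := by
  classical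
  let _ := Fintype.ofFinite (MulChar F ℂ)
  have := MulChar.isCyclic_complex F
  by_contra hne
  have hle := IsCyclic.card_pow_eq_one_le (α := MulChar F ℂ) (n := 2) (by norm_num)
  have hsub : ({1, φ, φ'} : Finset (MulChar F ℂ)) ⊆ ({a | a ^ 2 = 1} : Finset _) := by
    intro a ha
    simp only [mem_insert, mem_singleton] at ha
    rcases ha with h | h | h <;> simp [h, hφ2, hφ2']
  have hc : ({1, φ, φ'} : Finset (MulChar F ℂ)).card = 3 :=
    Finset.card_eq_three.mpr ⟨1, φ, φ', hφ.symm, hφ'.symm, hne, rfl⟩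
  have := Finset.card_le_card hsub
  omega

theorem card_sqrts_eq {F : Type*} [Field F] [Fintype F] [DecidableEq F] (hF : ringChar F ≠ 2)
    {φ : MulChar F ℂ} (hφ : φ ≠ 1) (hφ2 : φ ^ 2 = 1) (u : F) :
    ((univ.filter fun y : F => y ^ 2 = u).card : ℂ) = 1 + φ u := by
  have hinj := RingHom.injective_int (Int.castRingHom ℂ)
  have h : φ = (quadraticChar F).ringHomComp (Int.castRingHom ℂ) := by
    refine MulChar.eq_of_sq_eq_one hφ hφ2 ?_ ?_
    · exact (MulChar.ringHomComp_ne_one_iff hinj).mpr (quadraticChar_ne_one hF)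
    · exact ((quadraticChar_isQuadratic F).comp _).sq_eq_one
  have hc := quadraticChar_card_sqrts hF u
  have hs : {x : F | x ^ 2 = u}.toFinset = univ.filter fun y : F => y ^ 2 = u := by
    ext; simp
  rw [hs] at hc
  rw [h, MulChar.ringHomComp_apply, add_comm]
  have := congrArg (Int.cast (R := ℂ)) hc
  push_cast at this
  simpa using this

theorem sum_comp_sq {F : Type*} [Field F] [Fintype F] (hF : ringChar F ≠ 2)
    {φ : MulChar F ℂ} (hφ : φ ≠ 1) (hφ2 : φ ^ 2 = 1) (f : F → ℂ) :
    ∑ y, f (y ^ 2) = ∑ u, f u * (1 + φ u) := by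
  classical
  rw [← Finset.sum_fiberwise (s := univ) (g := fun y : F => y ^ 2)]
  refine Finset.sum_congr rfl fun u _ => ?_
  rw [← card_sqrts_eq hF hφ hφ2 u, Finset.sum_congr rfl (g := fun _ => f u), Finset.sum_const,
    nsmul_eq_mul, mul_comm]
  intro y hy
  rw [(mem_filter.mp hy).2]

theorem natCard_sq_eq {F : Type*} [Field F] [Fintype F] (hF : ringChar F ≠ 2)
    {φ : MulChar F ℂ} (hφ : φ ≠ 1) (hφ2 : φ ^ 2 = 1) (f : F → F) :
    ((Nat.card {xy : F × F // xy.2 ^ 2 = f xy.1} : ℕ) : ℂ) =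
      (Fintype.card F : ℂ) + ∑ x, φ (f x) := by
  classical
  rw [Nat.card_eq_fintype_card, Fintype.card_subtype, Finset.card_filter, Fintype.sum_prod_type]
  simp only [← Finset.card_filter]
  push_cast
  simp only [card_sqrts_eq hF hφ hφ2, Finset.sum_add_distrib]
  simp

theorem jacobiSum_self {F : Type*} [Field F] [Fintype F] (hF : ringChar F ≠ 2)
    {φ : MulChar F ℂ} (hφ : φ ≠ 1) (hφ2 : φ ^ 2 = 1) {χ : MulChar F ℂ} (hχ : χ ≠ 1) :
    jacobiSum χ χ = χ⁻¹ 4 * jacobiSum χ φ := by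
  have h2 : (2 : F) ≠ 0 := Ring.two_ne_zero hF
  have h4 : (4 : F) ≠ 0 := by rw [show (4 : F) = 2 * 2 by norm_num]; exact mul_ne_zero h2 h2
  have h := sum_comp_sq hF hφ hφ2 fun u => χ⁻¹ 4 * χ (1 - u)
  have hs : ∑ u, χ (1 - u) = 0 := by
    rw [← MulChar.sum_eq_zero_of_ne_one hχ]
    exact (Equiv.subLeft (1 : F)).sum_comp fun u => χ u
  simp only [mul_add, mul_one, Finset.sum_add_distrib, mul_assoc] at h
  rw [← Finset.mul_sum, ← Finset.mul_sum, hs, mul_zero, zero_add] at h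
  rw [jacobiSum_comm χ φ, jacobiSum, jacobiSum]
  simp only [mul_comm (φ _)]
  rw [Finset.mul_sum, ← h, Finset.mul_sum, eq_comm,
    ← ((Equiv.mulLeft₀ 2 h2).trans (Equiv.subLeft (1 : F))).sum_comp]
  refine Finset.sum_congr rfl fun x _ => ?_
  simp only [Equiv.trans_apply, Equiv.subLeft_apply, Equiv.mulLeft₀_apply]
  rw [MulChar.inv_apply', ← map_mul, ← map_mul]
  congr 1
  field_simp
  ring

/-- The Davenport–Hasse product relation for the quadratic character. -/
theorem gaussSum_mul_quadratic {F : Type*} [Field F] [Fintype F] (hF : ringChar F ≠ 2)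
    {φ : MulChar F ℂ} (hφ : φ ≠ 1) (hφ2 : φ ^ 2 = 1) {θ : AddChar F ℂ} (hθ : θ.IsPrimitive)
    (χ : MulChar F ℂ) :
    gaussSum χ θ * gaussSum (χ * φ) θ = χ⁻¹ 4 * gaussSum (χ ^ 2) θ * gaussSum φ θ := by
  have h2 : (2 : F) ≠ 0 := Ring.two_ne_zero hF
  have h4 : (4 : F) = 2 ^ 2 := by norm_num
  have h40 : IsUnit (4 : F) := by rw [h4]; exact (isUnit_iff_ne_zero.mpr h2).pow 2
  rcases eq_or_ne χ 1 with rfl | h1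
  · rw [one_mul, one_pow, inv_one, MulChar.one_apply h40, one_mul]
  rcases eq_or_ne χ φ with rfl | hne
  · have : χ⁻¹ 4 = 1 := by
      rw [MulChar.inv_apply', h4, ← inv_pow, map_pow,
        MulChar.apply_pow_eq_one hφ2 (inv_ne_zero h2)]
    rw [this, one_mul, ← pow_two, mul_comm]
  have hχ2 : χ ^ 2 ≠ 1 := fun h => hne (MulChar.eq_of_sq_eq_one h1 h hφ hφ2)
  have hχφ : χ * φ ≠ 1 := fun h => hne (by
    rw [← mul_one φ, ← h, mul_left_comm, ← pow_two, hφ2, mul_one])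
  have e1 := jacobiSum_mul_nontrivial (χ := χ) (φ := χ) (by rwa [← pow_two]) θ
  have e2 := jacobiSum_mul_nontrivial hχφ θ
  rw [jacobiSum_self hF hφ hφ2 h1, ← pow_two] at e1
  have hq : (Fintype.card F : ℂ) ≠ 0 := Nat.cast_ne_zero.mpr Fintype.card_ne_zero
  have hg := gaussSum_ne_zero_of_nontrivial hq h1 hθ
  apply mul_left_cancel₀ hg
  linear_combination (-gaussSum (χ * φ) θ) * e1 + χ⁻¹ 4 * gaussSum (χ ^ 2) θ * e2

theorem sum_inv_mul_quadratic {F : Type*} [Field F] [Fintype F] [DecidableEq F]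
    [DecidableEq (MulChar F ℂ)] {φ : MulChar F ℂ} (hm : φ (-1) = 1) (χ : MulChar F ℂ) (v : F) :
    ∑ c, χ⁻¹ c * φ (1 + v + c * v ^ 3) =
      χ (-1) * ((χ ^ 3) v * (χ⁻¹ * φ) (1 + v)) * jacobiSum χ⁻¹ φ +
        ((if v = 0 then (if χ = 1 then (Fintype.card F : ℂ) - 1 else 0) else 0) +
        (if v = -1 then (if χ = φ then (Fintype.card F : ℂ) - 1 else 0) else 0)) := by
  have hsum (η : MulChar F ℂ) : ∑ c, η c = if η = 1 then (Fintype.card F : ℂ) - 1 else 0 := by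
    split_ifs with h
    · rw [h, MulChar.sum_one_eq_card_units, Fintype.card_units, Nat.cast_sub Fintype.card_pos]
      simp
    · exact MulChar.sum_eq_zero_of_ne_one h
  rcases eq_or_ne v 0 with rfl | h0
  · simp [MulChar.map_zero, hsum]
  rcases eq_or_ne v (-1) with rfl | h1
  · have (c : F) : χ⁻¹ c * φ (1 + -1 + c * (-1) ^ 3) = (χ⁻¹ * φ) c := by
      rw [MulChar.mul_apply, show 1 + -1 + c * (-1) ^ 3 = -1 * c by ring, map_mul, hm, one_mul]
    simp only [this, hsum, inv_mul_eq_one]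
    simp [MulChar.map_zero]
  have h1' : 1 + v ≠ 0 := fun h => h1 (by linear_combination h)
  have hs : -(1 + v) / v ^ 3 ≠ 0 := div_ne_zero (neg_ne_zero.mpr h1') (pow_ne_zero 3 h0)
  rw [← Equiv.sum_comp (Equiv.mulLeft₀ _ hs)]
  simp only [h0, h1, if_false, add_zero, jacobiSum, Finset.mul_sum, Equiv.mulLeft₀_apply]
  refine Finset.sum_congr rfl fun d _ => ?_
  have e1 : χ⁻¹ (-(1 + v) / v ^ 3 * d) = χ (-1) * (χ ^ 3) v * χ⁻¹ (1 + v) * χ⁻¹ d := by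
    rw [MulChar.pow_apply' _ three_ne_zero, ← map_pow]
    simp only [MulChar.inv_apply', ← map_mul]
    congr 1
    rw [mul_inv, inv_div, div_eq_mul_inv, inv_neg]
    ring
  have e2 : 1 + v + -(1 + v) / v ^ 3 * d * v ^ 3 = (1 + v) * (1 - d) := by
    field_simp
    ring
  rw [e1, e2, map_mul, MulChar.mul_apply]
  ring

theorem sum_sum_inv_mul_quadratic {F : Type*} [Field F] [Fintype F]
    [DecidableEq (MulChar F ℂ)] {φ : MulChar F ℂ} (hm : φ (-1) = 1) (χ : MulChar F ℂ) :
    ∑ c, χ⁻¹ c * ∑ v, φ (1 + v + c * v ^ 3) =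
      jacobiSum χ⁻¹ φ * jacobiSum (χ ^ 3) (χ⁻¹ * φ) +
        ((if χ = 1 then (Fintype.card F : ℂ) - 1 else 0) +
          (if χ = φ then (Fintype.card F : ℂ) - 1 else 0)) := by
  classical
  simp only [Finset.mul_sum]
  rw [Finset.sum_comm]
  simp only [sum_inv_mul_quadratic hm, Finset.sum_add_distrib, Finset.sum_ite_eq', mem_univ,
    if_true]
  rw [← Finset.sum_mul, ← Finset.mul_sum]
  have : ∑ v, (χ ^ 3) v * (χ⁻¹ * φ) (1 + v) = χ (-1) * jacobiSum (χ ^ 3) (χ⁻¹ * φ) := by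
    rw [jacobiSum, ← Equiv.sum_comp (Equiv.neg F), Finset.mul_sum]
    refine Finset.sum_congr rfl fun v _ => ?_
    have e : (χ ^ 3) (-1) = χ (-1) := by
      rw [MulChar.pow_apply' _ three_ne_zero, ← map_pow]; norm_num
    rw [Equiv.neg_apply, ← sub_eq_add_neg, ← neg_one_mul v, map_mul, e, mul_assoc]
  have hs : χ (-1) * χ (-1) = 1 := by rw [← map_mul]; simp
  rw [this, ← mul_assoc, hs]
  ring

theorem gaussSum_mul_gaussSum_inv {F : Type*} [Field F] [Fintype F] {χ : MulChar F ℂ} (hχ : χ ≠ 1)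
    {θ : AddChar F ℂ} (hθ : θ.IsPrimitive) :
    gaussSum χ θ * gaussSum χ⁻¹ θ = χ (-1) * Fintype.card F := by
  rw [← gaussSum_mul_gaussSum_eq_card hχ hθ, ← mul_gaussSum_inv_eq_gaussSum χ⁻¹ θ,
    MulChar.inv_apply', inv_neg_one]
  ring

theorem sum_sum_inv_mul_quadratic_mul_gaussSum {F : Type*} [Field F] [Fintype F]
    {φ : MulChar F ℂ} (hφ : φ ≠ 1) (hφ2 : φ ^ 2 = 1) (hm : φ (-1) = 1)
    {θ : AddChar F ℂ} (hθ : θ.IsPrimitive) (χ : MulChar F ℂ) :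
    (∑ c, χ⁻¹ c * ∑ v, φ (1 + v + c * v ^ 3)) * gaussSum χ θ =
      χ (-1) * gaussSum (χ ^ 3) θ * gaussSum ((χ ^ 2)⁻¹ * φ) θ * gaussSum φ θ := by
  classical
  rw [sum_sum_inv_mul_quadratic hm]
  have hq : (Fintype.card F : ℂ) ≠ 0 := Nat.cast_ne_zero.mpr Fintype.card_ne_zero
  have hφi : φ⁻¹ = φ := by rw [inv_eq_iff_mul_eq_one, ← pow_two, hφ2]
  have hφφ : φ * φ = 1 := by rw [← pow_two, hφ2]
  have hφ3 : φ ^ 3 = φ := by rw [pow_succ, hφ2, one_mul]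
  have hgφ := gaussSum_mul_gaussSum_inv hφ hθ
  rw [hφi, hm, one_mul] at hgφ
  rcases eq_or_ne χ 1 with rfl | h1
  · rw [if_pos rfl, if_neg hφ.symm, inv_one, one_pow, one_pow, inv_one, one_mul,
      jacobiSum_one_nontrivial hφ, gaussSum_one_left hθ.ne_one', MulChar.one_apply isUnit_one.neg]
    linear_combination hgφ
  rcases eq_or_ne χ φ with rfl | h2
  · rw [if_neg h1, if_pos rfl, hφi, hφφ, hφ3, hφ2, inv_one, one_mul, jacobiSum_comm χ 1,
      jacobiSum_one_nontrivial hφ, hm]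
    have := jacobiSum_nontrivial_inv hφ
    rw [hφi, hm] at this
    rw [this]
    linear_combination -gaussSum χ θ * hgφ
  rw [if_neg h1, if_neg h2, add_zero, add_zero]
  have h3 : χ⁻¹ * φ ≠ 1 := by rwa [Ne, inv_mul_eq_one]
  have e1 := jacobiSum_mul_nontrivial h3 θ
  by_cases h4 : χ ^ 2 = φ
  · have h5 : χ⁻¹ * φ = χ := by rw [← h4, pow_two, inv_mul_cancel_left]
    have h6 : χ ^ 3 = χ⁻¹ := by
      rw [eq_inv_iff_mul_eq_one, ← pow_succ, show 3 + 1 = 2 * 2 by norm_num, pow_mul, h4, hφ2]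
    have h7 := jacobiSum_nontrivial_inv h1
    rw [h5] at e1 ⊢
    rw [h6, jacobiSum_comm χ⁻¹ χ, h7, h4, inv_mul_cancel, gaussSum_one_left hθ.ne_one']
    linear_combination -χ (-1) * e1
  · have h5 : χ ^ 3 * (χ⁻¹ * φ) = χ ^ 2 * φ := by
      rw [← mul_assoc, pow_succ, mul_inv_cancel_right]
    have h6 : χ ^ 2 * φ ≠ 1 := by
      rw [Ne, mul_eq_one_iff_eq_inv, hφi]; exact h4
    have e2 := jacobiSum_mul_nontrivial (h5 ▸ h6) θ
    rw [h5] at e2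
    have e3 := gaussSum_mul_gaussSum_inv h6 hθ
    have h7 : (χ ^ 2 * φ) (-1) = 1 := by
      rw [MulChar.mul_apply, MulChar.pow_apply' _ two_ne_zero, ← map_pow, hm]; simp
    rw [mul_inv, hφi, h7, one_mul] at e3
    have e4 := gaussSum_mul_gaussSum_inv h1 hθ
    have hg := gaussSum_ne_zero_of_nontrivial hq h3 hθ
    apply mul_left_cancel₀ hg
    apply mul_left_cancel₀ hq
    set A := jacobiSum χ⁻¹ φ
    set B := jacobiSum (χ ^ 3) (χ⁻¹ * φ)
    set g := gaussSum χ θ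
    set g' := gaussSum χ⁻¹ θ
    set a := gaussSum (χ⁻¹ * φ) θ
    set b := gaussSum (χ ^ 2 * φ) θ
    set b' := gaussSum ((χ ^ 2)⁻¹ * φ) θ
    set c := gaussSum (χ ^ 3) θ
    set d := gaussSum φ θ
    linear_combination (-a * A * B * g) * e3 + b' * g * b * B * e1 + b' * g * g' * d * e2 +
      b' * a * c * d * e4

/-- The coefficients of the character expansion of `c ↦ ∑ v, φ (1 + v + c * v ^ 3)`, where
`φ = ψ ^ 6` is quadratic, are products of two Jacobi sums. -/
theorem sum_sum_inv_mul_quadratic_eq {F : Type*} [Field F] [Fintype F] (hF : ringChar F ≠ 2)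
    (h3 : (3 : F) ≠ 0) {ζ : F} (hζ : ζ ^ 2 + ζ + 1 = 0) {ψ : MulChar F ℂ} (hψ : ψ ^ 12 = 1)
    (hψ4 : ψ ^ 4 ≠ 1) (hψ6 : ψ ^ 6 ≠ 1) {θ : AddChar F ℂ} (hθ : θ.IsPrimitive)
    (χ : MulChar F ℂ) :
    ∑ c, χ⁻¹ c * ∑ v, (ψ ^ 6) (1 + v + c * v ^ 3) =
      χ (-27 / 4) * (ψ ^ 3) (-1 / 4) *
        (jacobiSum (χ * ψ ^ 4) (χ * ψ ^ 3)⁻¹ * jacobiSum (χ * ψ ^ 8) (χ⁻¹ * ψ ^ 3)) := by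
  have h2 : (2 : F) ≠ 0 := Ring.two_ne_zero hF
  have h4 : (4 : F) ≠ 0 := by rw [show (4 : F) = 2 * 2 by norm_num]; exact mul_ne_zero h2 h2
  have h27 : (27 : F) ≠ 0 := by rw [show (27 : F) = 3 ^ 3 by norm_num]; exact pow_ne_zero 3 h3
  have hψ1 : ψ ≠ 1 := fun h => hψ4 (by rw [h, one_pow])
  have hψ66 : (ψ ^ 6) ^ 2 = 1 := by rw [← pow_mul, hψ]
  have hψ43 : (ψ ^ 4) ^ 3 = 1 := by rw [← pow_mul, hψ]
  have hψ6i : (ψ ^ 6)⁻¹ = ψ ^ 6 := by rw [inv_eq_iff_mul_eq_one, ← pow_two, hψ66]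
  have hψ11 : ψ ^ 11 = ψ⁻¹ := by rw [eq_inv_iff_mul_eq_one, ← pow_succ, hψ]
  have hs : ψ (-1) * ψ (-1) = 1 := by rw [← map_mul]; simp
  have hm : (ψ ^ 6) (-1) = 1 := by
    rw [MulChar.pow_apply' _ (by norm_num), ← map_pow, Even.neg_one_pow ⟨3, rfl⟩, map_one]
  have hi : (ψ ^ 3) (-1) = ψ (-1) := by
    rw [MulChar.pow_apply' _ (by norm_num), ← map_pow]; norm_num
  have c1 : χ * ψ ^ 4 * (χ * ψ ^ 3)⁻¹ = ψ := by
    rw [pow_succ' ψ 3, mul_left_comm, mul_inv_cancel_right]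
  have c2 : χ * ψ ^ 8 * (χ⁻¹ * ψ ^ 3) = ψ⁻¹ := by
    rw [mul_mul_mul_comm, mul_inv_cancel, one_mul, ← pow_add, hψ11]
  have c3 : (χ * ψ ^ 3)⁻¹ * ψ ^ 6 = χ⁻¹ * ψ ^ 3 := by
    rw [mul_inv, mul_assoc, show 6 = 3 + 3 from rfl, pow_add, inv_mul_cancel_left]
  have c4 : ((χ * ψ ^ 3)⁻¹) ^ 2 = (χ ^ 2)⁻¹ * ψ ^ 6 := by
    rw [inv_pow, mul_pow, mul_inv, ← pow_mul, hψ6i]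
  have e0 := sum_sum_inv_mul_quadratic_mul_gaussSum hψ6 hψ66 hm hθ χ
  have e1 := jacobiSum_mul_nontrivial (c1.trans_ne hψ1) θ
  have e2 := jacobiSum_mul_nontrivial (c2.trans_ne (inv_ne_one.mpr hψ1)) θ
  have e3 := gaussSum_mul_gaussSum_inv hψ1 hθ
  have e4 := gaussSum_mul_mul_eq h3 hζ hψ4 hψ43 hθ χ
  have e5 := gaussSum_mul_quadratic hF hψ6 hψ66 hθ (χ * ψ ^ 3)⁻¹
  rw [← pow_mul] at e4
  rw [c1] at e1
  rw [c2] at e2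
  rw [c3, c4, inv_inv] at e5
  have hC : ψ (-1) * (χ (-27 / 4) * (ψ ^ 3) (-1 / 4) * χ⁻¹ 27 * (χ * ψ ^ 3) 4) = χ (-1) := by
    have t1 : χ (-27 / 4) * χ⁻¹ 27 * χ 4 = χ (-1) := by
      rw [MulChar.inv_apply', ← map_mul, ← map_mul]
      congr 1
      field_simp
    have t2 : (ψ ^ 3) (-1 / 4) * (ψ ^ 3) 4 = ψ (-1) := by
      rw [← hi, ← map_mul]
      congr 1
      field_simp
    rw [MulChar.mul_apply]
    linear_combination ψ (-1) * (ψ ^ 3) (-1 / 4) * (ψ ^ 3) 4 * t1 + ψ (-1) * χ (-1) * t2 +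
      χ (-1) * hs
  have hq : (Fintype.card F : ℂ) ≠ 0 := Nat.cast_ne_zero.mpr Fintype.card_ne_zero
  have hg : gaussSum χ θ ≠ 0 := by
    rcases eq_or_ne χ 1 with rfl | h1
    · rw [gaussSum_one_left hθ.ne_one']; norm_num
    · exact gaussSum_ne_zero_of_nontrivial hq h1 hθ
  apply mul_right_cancel₀ hg
  apply mul_left_cancel₀ hq
  rw [e0]
  generalize χ (-27 / 4) * (ψ ^ 3) (-1 / 4) = C at hC ⊢
  generalize jacobiSum (χ * ψ ^ 4) (χ * ψ ^ 3)⁻¹ = J₁ at *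
  generalize jacobiSum (χ * ψ ^ 8) (χ⁻¹ * ψ ^ 3) = J₂ at *
  generalize gaussSum (χ * ψ ^ 4) θ = A at *
  generalize gaussSum (χ * ψ ^ 8) θ = B at *
  generalize gaussSum (χ * ψ ^ 3)⁻¹ θ = D at *
  generalize gaussSum (χ⁻¹ * ψ ^ 3) θ = E at *
  generalize gaussSum χ θ = G at *
  generalize gaussSum ψ θ = P at *
  generalize gaussSum ψ⁻¹ θ = P' at *
  generalize gaussSum (χ ^ 3) θ = K at *
  generalize gaussSum ((χ ^ 2)⁻¹ * ψ ^ 6) θ = L at *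
  generalize gaussSum (ψ ^ 6) θ = M at *
  generalize (Fintype.card F : ℂ) = q at *
  generalize (χ * ψ ^ 3) 4 = u at *
  linear_combination (-q * K * L * M) * hC + ψ (-1) * C * q * χ⁻¹ 27 * K * (-1) * e5 +
    (-ψ (-1) * C * D * E) * e4 - ψ (-1) * C * G * A * D * e2 - ψ (-1) * C * G * P' * J₂ * e1 +
    ψ (-1) * C * G * J₁ * J₂ * e3 + q * C * G * J₁ * J₂ * hs

theorem sum_quadratic_eq_sum_jacobiSum {F : Type*} [Field F] [Fintype F]
    [Fintype (MulChar F ℂ)] (hF : ringChar F ≠ 2)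
    (h3 : (3 : F) ≠ 0) {ζ : F} (hζ : ζ ^ 2 + ζ + 1 = 0) {ψ : MulChar F ℂ} (hψ : ψ ^ 12 = 1)
    (hψ4 : ψ ^ 4 ≠ 1) (hψ6 : ψ ^ 6 ≠ 1) {θ : AddChar F ℂ} (hθ : θ.IsPrimitive)
    {c : F} (hc : c ≠ 0) :
    ((Fintype.card F : ℂ) - 1) * ∑ v, (ψ ^ 6) (1 + v + c * v ^ 3) =
      (ψ ^ 3)⁻¹ (27 * c) * ∑ χ : MulChar F ℂ, χ (-27 * c / 4) *
        (jacobiSum (ψ * χ) χ⁻¹ * jacobiSum (ψ ^ 5 * χ) (ψ ^ 6 * χ)⁻¹) := by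
  have h2 : (2 : F) ≠ 0 := Ring.two_ne_zero hF
  have h4 : (4 : F) ≠ 0 := by rw [show (4 : F) = 2 * 2 by norm_num]; exact mul_ne_zero h2 h2
  have h27 : (27 : F) ≠ 0 := by rw [show (27 : F) = 3 ^ 3 by norm_num]; exact pow_ne_zero 3 h3
  have hψ6i : (ψ ^ 6)⁻¹ = ψ ^ 6 := by
    rw [inv_eq_iff_mul_eq_one, ← pow_add, hψ]
  rw [← MulChar.sum_mul_sum_inv (fun c => ∑ v, (ψ ^ 6) (1 + v + c * v ^ 3)) hc]
  simp only [sum_sum_inv_mul_quadratic_eq hF h3 hζ hψ hψ4 hψ6 hθ]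
  rw [← Equiv.sum_comp (Equiv.mulRight (ψ ^ 3)⁻¹), Finset.mul_sum]
  refine Finset.sum_congr rfl fun χ _ => ?_
  rw [Equiv.coe_mulRight]
  have c1 : χ * (ψ ^ 3)⁻¹ * ψ ^ 4 = ψ * χ := by
    rw [pow_succ ψ 3, ← mul_assoc, inv_mul_cancel_right, mul_comm]
  have c2 : χ * (ψ ^ 3)⁻¹ * ψ ^ 3 = χ := inv_mul_cancel_right _ _
  have c3 : χ * (ψ ^ 3)⁻¹ * ψ ^ 8 = ψ ^ 5 * χ := by
    rw [show 8 = 3 + 5 from rfl, pow_add ψ 3, ← mul_assoc, inv_mul_cancel_right, mul_comm]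
  have c4 : (χ * (ψ ^ 3)⁻¹)⁻¹ * ψ ^ 3 = (ψ ^ 6 * χ)⁻¹ := by
    rw [mul_inv, inv_inv, mul_inv, hψ6i, mul_assoc, ← pow_add, mul_comm]
  rw [c1, c2, c3, c4]
  have t1 : χ c * χ (-27 / 4) = χ (-27 * c / 4) := by
    rw [← map_mul]; congr 1; ring
  have t2 : (ψ ^ 3)⁻¹ c * (ψ ^ 3)⁻¹ (-27 / 4) * (ψ ^ 3) (-1 / 4) = (ψ ^ 3)⁻¹ (27 * c) := by
    simp only [MulChar.inv_apply', ← map_mul]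
    congr 1
    field_simp
  rw [← t1, ← t2, MulChar.mul_apply, MulChar.mul_apply]
  ring

theorem sum_weierstrass_eq {F : Type*} [Field F] [Fintype F] (φ : MulChar F ℂ) {a b : F}
    (ha : a ≠ 0) (hb : b ≠ 0) :
    ∑ x, φ (x ^ 3 + a * x + b) = φ b * ∑ v, φ (1 + v + b ^ 2 / a ^ 3 * v ^ 3) := by
  rw [← Equiv.sum_comp (Equiv.mulLeft₀ (b / a) (div_ne_zero hb ha)), Finset.mul_sum]
  refine Finset.sum_congr rfl fun v _ => ?_
  rw [← map_mul, Equiv.mulLeft₀_apply]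
  congr 1
  field_simp
  ring

theorem sum_range_pow_eq_sum {G M : Type*} [Group G] [Fintype G] [AddCommMonoid M] {g : G}
    (hg : ∀ x, ∃ n : ℕ, x = g ^ n) (f : G → M) :
    ∑ m ∈ range (Fintype.card G), f (g ^ m) = ∑ x, f x := by
  have ho : orderOf g = Fintype.card G := by
    rw [← Nat.card_eq_fintype_card]
    refine orderOf_eq_card_of_forall_mem_zpowers fun x => ?_
    obtain ⟨n, rfl⟩ := hg x
    exact ⟨n, zpow_natCast g n⟩
  refine Finset.sum_nbij (fun m => g ^ m) (fun _ _ => mem_univ _) ?_ ?_ (fun _ _ => rfl)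
  · intro m hm n hn h
    rw [coe_range, ← ho] at hm hn
    exact pow_injOn_Iio_orderOf hm hn h
  · intro x _
    obtain ⟨n, rfl⟩ := hg x
    refine ⟨n % orderOf g, ?_, pow_mod_orderOf g n⟩
    rw [coe_range, ← ho]
    exact Nat.mod_lt _ (orderOf_pos g)

theorem FiniteField.exists_sq_add_self_add_one_eq_zero {F : Type*} [Field F] [Fintype F]
    (h : 3 ∣ Fintype.card F - 1) : ∃ ζ : F, ζ ^ 2 + ζ + 1 = 0 := by
  classical
  have : Fact (Nat.Prime 3) := ⟨Nat.prime_three⟩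
  rw [← Fintype.card_units] at h
  obtain ⟨u, hu⟩ := exists_prime_orderOf_dvd_card 3 h
  have hu3 : (u : F) ^ 3 = 1 := by
    rw [← Units.val_pow_eq_pow_val, ← hu, pow_orderOf_eq_one, Units.val_one]
  have hu1 : (u : F) - 1 ≠ 0 := fun h => by
    rw [orderOf_eq_one_iff.mpr (Units.ext (sub_eq_zero.mp h))] at hu
    norm_num at hu
  exact ⟨u, mul_left_cancel₀ hu1 (by linear_combination hu3)⟩

theorem stmt_9 (p e : ℕ) [Fact p.Prime] (hp : 3 < p) (he : 0 < e)
    (F : Type) [Field F] [Fintype F]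
    (hq : Fintype.card F = p ^ e) (h12 : Fintype.card F % 12 = 1)
    (a b : F) (ha : a ≠ 0) (hb : b ≠ 0) (hΔ : 4 * a ^ 3 + 27 * b ^ 2 ≠ 0)
    (T : MulChar F ℂ) (hT : ∀ χ : MulChar F ℂ, ∃ n : ℕ, χ = T ^ n) :
    ((Nat.card {xy : F × F // xy.2 ^ 2 = xy.1 ^ 3 + a * xy.1 + b} : ℕ) : ℂ) =
      (Fintype.card F : ℂ) +
        (T ^ ((Fintype.card F - 1) / 4)) (a ^ 3 / 27) * (Fintype.card F : ℂ) *
          hypF21 F T (T ^ ((Fintype.card F - 1) / 12)) (T ^ (5 * ((Fintype.card F - 1) / 12)))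
            (T ^ ((Fintype.card F - 1) / 2)) (-27 * b ^ 2 / (4 * a ^ 3)) := by
  classical
  let _ := Fintype.ofFinite (MulChar F ℂ)
  have hcard := MulChar.card_complex F
  have hp' : p.Prime := Fact.out
  have hchar : ringChar F = p := by
    have hdvd : ringChar F ∣ p :=
      (CharP.char_is_prime F (ringChar F)).dvd_of_dvd_pow (n := e) (by
        rw [← hq, ← ringChar.spec, Nat.cast_card_eq_zero])
    exact (Nat.prime_dvd_prime_iff_eq (CharP.char_is_prime F (ringChar F)) hp').mp hdvd
  have hF : ringChar F ≠ 2 := by omega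
  have h3 : (3 : F) ≠ 0 := fun h => by
    have hdvd := (ringChar.spec F 3).mp (by exact_mod_cast h)
    have := Nat.le_of_dvd (by norm_num) hdvd
    omega
  have hk : Fintype.card F - 1 = 12 * (Fintype.card F / 12) := by omega
  have hk0 : 0 < Fintype.card F / 12 := by
    have := Fintype.one_lt_card (α := F)
    omega
  obtain ⟨ζ, hζ⟩ := FiniteField.exists_sq_add_self_add_one_eq_zero (F := F) (by omega)
  have hθ := AddChar.FiniteField.primitiveChar_to_Complex_isPrimitive F
  have ho : orderOf T = 12 * (Fintype.card F / 12) := by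
    rw [← hk, ← hcard, ← Nat.card_eq_fintype_card]
    refine orderOf_eq_card_of_forall_mem_zpowers fun x => ?_
    obtain ⟨n, rfl⟩ := hT x
    exact ⟨n, zpow_natCast T n⟩
  rw [hypF21, hk]
  have d2 : 12 * (Fintype.card F / 12) / 2 = Fintype.card F / 12 * 6 := by omega
  have d4 : 12 * (Fintype.card F / 12) / 4 = Fintype.card F / 12 * 3 := by omega
  have d12 : 12 * (Fintype.card F / 12) / 12 = Fintype.card F / 12 := by omega
  rw [d2, d4, d12, mul_comm 5, pow_mul, pow_mul, pow_mul, ← hk, ← hcard]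
  have hψ : (T ^ (Fintype.card F / 12)) ^ 12 = 1 := by
    rw [← pow_mul, mul_comm, ← ho, pow_orderOf_eq_one]
  have hne {n : ℕ} (hn0 : n ≠ 0) (hn : n < 12) : (T ^ (Fintype.card F / 12)) ^ n ≠ 1 := by
    rw [← pow_mul]
    refine pow_ne_one_of_lt_orderOf (by positivity) ?_
    rw [ho, mul_comm]
    exact Nat.mul_lt_mul_of_pos_right hn hk0
  generalize T ^ (Fintype.card F / 12) = ψ at hψ hne ⊢
  have hψ66 : (ψ ^ 6) ^ 2 = 1 := by rw [← pow_mul, hψ]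
  have hm : (ψ ^ 6) (-1) = 1 := by
    rw [MulChar.pow_apply' _ (by norm_num), ← map_pow, Even.neg_one_pow ⟨3, rfl⟩, map_one]
  have h27 : (27 : F) ≠ 0 := by rw [show (27 : F) = 3 ^ 3 by norm_num]; exact pow_ne_zero 3 h3
  have hc : b ^ 2 / a ^ 3 ≠ 0 := div_ne_zero (pow_ne_zero 2 hb) (pow_ne_zero 3 ha)
  have hq0 : (Fintype.card F : ℂ) ≠ 0 := Nat.cast_ne_zero.mpr Fintype.card_ne_zero
  have hq1 : (Fintype.card F : ℂ) - 1 ≠ 0 :=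
    sub_ne_zero.mpr (Nat.cast_ne_one.mpr Fintype.one_lt_card.ne')
  have key := sum_quadratic_eq_sum_jacobiSum hF h3 hζ hψ (hne (by norm_num) (by norm_num))
    (hne (by norm_num) (by norm_num)) hθ hc
  rw [sum_range_pow_eq_sum hT fun χ => binomC F (ψ * χ) χ * binomC F (ψ ^ 5 * χ) (ψ ^ 6 * χ) *
    χ (-27 * b ^ 2 / (4 * a ^ 3)), natCard_sq_eq hF (hne (by norm_num) (by norm_num)) hψ66
      fun x => x ^ 3 + a * x + b, sum_weierstrass_eq _ ha hb]
  have hbin (χ : MulChar F ℂ) : binomC F (ψ * χ) χ * binomC F (ψ ^ 5 * χ) (ψ ^ 6 * χ) *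
      χ (-27 * b ^ 2 / (4 * a ^ 3)) = ((Fintype.card F : ℂ) ^ 2)⁻¹ *
        (χ (-27 * (b ^ 2 / a ^ 3) / 4) *
        (jacobiSum (ψ * χ) χ⁻¹ * jacobiSum (ψ ^ 5 * χ) (ψ ^ 6 * χ)⁻¹)) := by
    have hs : χ (-1) * χ (-1) = 1 := by rw [← map_mul]; simp
    have ht : -27 * (b ^ 2 / a ^ 3) / 4 = -27 * b ^ 2 / (4 * a ^ 3) := by
      rw [mul_div_assoc', div_div, mul_comm 4]
    rw [binomC, binomC, MulChar.mul_apply, hm, one_mul, ht]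
    generalize χ (-27 * b ^ 2 / (4 * a ^ 3)) = t
    field_simp
    linear_combination jacobiSum (ψ * χ) χ⁻¹ * jacobiSum (ψ ^ 5 * χ) (ψ ^ 6 * χ)⁻¹ * t * hs
  have hpre : (ψ ^ 6) b * (ψ ^ 3)⁻¹ (27 * (b ^ 2 / a ^ 3)) = (ψ ^ 3) (a ^ 3 / 27) := by
    rw [show 6 = 3 * 2 from rfl, pow_mul, MulChar.pow_apply' _ two_ne_zero, ← map_pow,
      MulChar.inv_apply', ← map_mul]
    congr 1
    field_simp
  simp only [hbin]
  rw [← Finset.mul_sum, ← hpre]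
  congr 1
  apply mul_left_cancel₀ hq1
  rw [mul_left_comm, key]
  field_simp
end

section
/- Let q = p^e with p > 3 prime and q ≡ 1 (mod 12). Let E: y² = x³ + ax + b be an elliptic curve over F_q with j(E) ≠ 0, 1728 and T a generator of the character group of F_q^*. Then the trace of Frobenius a(E/F_q) := q + 1 − #E(F_q) (projective point count) satisfies a(E/F_q) = −q · T^{(q-1)/4}(a³/27) · ₂F₁(T^{(q-1)/12}, T^{5(q-1)/12}; T^{(q-1)/2} | -27b²/(4a³))_q. -/
open Finset

section CharacterSums

variable {F : Type} [Field F]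

theorem MulChar.apply_units_pow_eq_one {χ : MulChar F ℂ} {d : ℕ} (h : χ ^ d = 1) (a : Fˣ) :
    χ a ^ d = 1 := by
  rw [← MulChar.pow_apply_coe, h, MulChar.one_apply_coe]

theorem ringChar_ne_two (h2 : (2 : F) ≠ 0) : ringChar F ≠ 2 := fun h ↦
  h2 (by simpa [h] using ringChar.Nat.cast_ringChar (R := F))

theorem apply_neg_one_sq (χ : MulChar F ℂ) : χ (-1) ^ 2 = 1 := by
  rw [← map_pow]; simp

variable [Fintype F]

theorem MulChar.exists_forall_ext_of_apply_eq (F : Type) [Field F] [Fintype F] :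
    ∃ γ : Fˣ, (∀ x : Fˣ, x ∈ Subgroup.zpowers γ) ∧
      ∀ χ χ' : MulChar F ℂ, χ γ = χ' γ → χ = χ' := by
  obtain ⟨γ, hγ⟩ := IsCyclic.exists_generator (α := Fˣ)
  refine ⟨γ, hγ, fun χ χ' h ↦ MulChar.ext fun a ↦ ?_⟩
  obtain ⟨k, rfl⟩ := (mem_powers_iff_mem_zpowers).2 (hγ a)
  simp [h]

theorem MulChar.sum_units_pow_prime [DecidableEq F] {d : ℕ} (hd : d.Prime) {χ : MulChar F ℂ}
    (h1 : χ ≠ 1) (hχ : χ ^ d = 1) (G : Fˣ → ℂ) :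
    ∑ x : Fˣ, G (x ^ d) = ∑ r : Fˣ, (∑ i ∈ range d, χ r ^ i) * G r := by
  obtain ⟨γ, hγ, hext⟩ := MulChar.exists_forall_ext_of_apply_eq F
  have hγ1 : χ γ ≠ 1 := fun h ↦ h1 (hext _ _ (by rw [h, MulChar.one_apply_coe]))
  have hord : orderOf (χ (γ : F)) = d :=
    orderOf_eq_prime (MulChar.apply_units_pow_eq_one hχ γ) hγ1 (hp := ⟨hd⟩)
  have hdvd : d ∣ Nat.card Fˣ := by
    rw [← hord, orderOf_dvd_iff_pow_eq_one, ← map_pow, ← Units.val_pow_eq_pow_val, pow_card_eq_one',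
      Units.val_one, map_one]
  have hker : #{x : Fˣ | x ^ d = 1} = d := by
    have h := IsCyclic.card_powMonoidHom_ker (G := Fˣ) d
    rw [Nat.gcd_eq_right hdvd] at h
    refine Eq.trans ?_ h
    rw [Nat.card_eq_fintype_card, Fintype.card_subtype]
    simp [MonoidHom.mem_ker]
  have hfib : ∀ r : Fˣ, (#{x : Fˣ | x ^ d = r} : ℂ) = ∑ i ∈ range d, χ r ^ i := by
    intro r
    obtain ⟨k, rfl⟩ := (mem_powers_iff_mem_zpowers).2 (hγ r)
    simp only
    by_cases hk : d ∣ k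
    · obtain ⟨j, rfl⟩ := hk
      have h1 : χ ((γ ^ (d * j) : Fˣ) : F) = 1 := by
        rw [pow_mul, Units.val_pow_eq_pow_val, map_pow, Units.val_pow_eq_pow_val, map_pow,
          MulChar.apply_units_pow_eq_one hχ, one_pow]
      rw [h1]
      simp only [one_pow, sum_const, card_range, nsmul_eq_mul, mul_one, Nat.cast_inj]
      conv_rhs => rw [← hker]
      refine card_bij (fun x _ ↦ x * (γ ^ j)⁻¹) ?_ ?_ ?_
      · intro x hx
        simp only [mem_filter, mem_univ, true_and] at hx ⊢
        rw [mul_pow, hx, inv_pow, ← pow_mul, mul_comm j d, mul_inv_cancel]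
      · intro x _ y _ h
        exact mul_right_cancel h
      · intro x hx
        simp only [mem_filter, mem_univ, true_and] at hx ⊢
        exact ⟨x * γ ^ j, by rw [mul_pow, hx, one_mul, ← pow_mul, mul_comm], by simp⟩
    · have h0 : χ ((γ ^ k : Fˣ) : F) ≠ 1 := by
        rw [Units.val_pow_eq_pow_val, map_pow]
        intro h
        exact hk (hord ▸ orderOf_dvd_of_pow_eq_one h)
      have hz : ∑ i ∈ range d, χ ((γ ^ k : Fˣ) : F) ^ i = 0 := by
        have := mul_geom_sum (χ ((γ ^ k : Fˣ) : F)) d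
        rw [MulChar.apply_units_pow_eq_one hχ, sub_self] at this
        exact (mul_eq_zero.1 this).resolve_left (sub_ne_zero.2 h0)
      rw [hz, Nat.cast_eq_zero, card_eq_zero, filter_eq_empty_iff]
      intro x _ hx
      apply h0
      rw [← hx, Units.val_pow_eq_pow_val, map_pow, MulChar.apply_units_pow_eq_one hχ]
  simp_rw [← hfib]
  rw [← sum_fiberwise (s := univ) (g := fun x : Fˣ ↦ x ^ d)]
  refine sum_congr rfl fun r _ ↦ ?_
  rw [sum_congr rfl (g := fun _ ↦ G r), sum_const, nsmul_eq_mul]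
  intro x hx
  rw [(mem_filter.1 hx).2]

theorem eq_one_or_of_pow_three {ω ρ : MulChar F ℂ} (h1 : ω ≠ 1) (hω : ω ^ 3 = 1) (hρ : ρ ^ 3 = 1) :
    ρ = 1 ∨ ρ = ω ∨ ρ = ω⁻¹ := by
  obtain ⟨γ, hγ, hext⟩ := MulChar.exists_forall_ext_of_apply_eq F
  have hw := MulChar.apply_units_pow_eq_one hω γ
  have hr := MulChar.apply_units_pow_eq_one hρ γ
  have hw1 : ω γ ≠ 1 := fun e ↦ h1 (hext _ _ (by rw [e, MulChar.one_apply_coe]))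
  have hinv : ω⁻¹ = ω ^ 2 := inv_eq_of_mul_eq_one_right (by rw [← hω, pow_succ' ω 2])
  have hq : ω γ ^ 2 + ω γ + 1 = 0 := by
    have : (ω γ - 1) * (ω γ ^ 2 + ω γ + 1) = 0 := by linear_combination hw
    exact (mul_eq_zero.1 this).resolve_left (sub_ne_zero.2 hw1)
  have : (ρ γ - 1) * ((ρ γ - ω γ) * (ρ γ - ω γ ^ 2)) = 0 := by
    linear_combination hr - (ρ γ - 1) * (ρ γ) * hq + (ρ γ - 1) * hw
  rcases mul_eq_zero.1 this with h | h
  · exact Or.inl (hext _ _ (by rw [sub_eq_zero.1 h, MulChar.one_apply_coe]))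
  rcases mul_eq_zero.1 h with h | h
  · exact Or.inr (Or.inl (hext _ _ (sub_eq_zero.1 h)))
  · refine Or.inr (Or.inr (hext _ _ ?_))
    rw [hinv, MulChar.pow_apply_coe]
    exact sub_eq_zero.1 h

variable {ψ : AddChar F ℂ}

theorem gaussSum_mul_gaussSum_inv_eq {χ : MulChar F ℂ} (hχ : χ ≠ 1) (hψ : ψ.IsPrimitive) :
    gaussSum χ ψ * gaussSum χ⁻¹ ψ = χ (-1) * Fintype.card F := by
  rw [← gaussSum_mul_gaussSum_eq_card hχ hψ, ← mul_gaussSum_inv_eq_gaussSum χ⁻¹ ψ,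
    MulChar.inv_apply', inv_neg, inv_one]
  ring

theorem gaussSum_one_left_of_isPrimitive (hψ : ψ.IsPrimitive) : gaussSum (1 : MulChar F ℂ) ψ = -1 :=
  gaussSum_one_left fun h ↦ by
    have := hψ one_ne_zero
    rw [h] at this
    exact this (by ext; simp)

theorem gaussSum_ne_zero_of_isPrimitive (hψ : ψ.IsPrimitive) (χ : MulChar F ℂ) :
    gaussSum χ ψ ≠ 0 := by
  by_cases h : χ = 1
  · rw [h, gaussSum_one_left_of_isPrimitive hψ]; norm_num
  · exact gaussSum_ne_zero_of_nontrivial (by simp) h hψ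

theorem exists_addChar_isPrimitive : ∃ ψ : AddChar F ℂ, ψ.IsPrimitive := by
  obtain ⟨ψ, h⟩ := AddChar.exists_apply_ne_zero.2 (one_ne_zero (α := F))
  exact ⟨ψ, AddChar.IsPrimitive.of_ne_one fun e ↦ h (by rw [e]; rfl)⟩

variable [DecidableEq F]

/-- The quadratic character of a finite field with complex values. -/
noncomputable def complexQuadraticChar (F : Type) [Field F] [Fintype F] [DecidableEq F] :
    MulChar F ℂ :=
  (quadraticChar F).ringHomComp (Int.castRingHom ℂ)

theorem complexQuadraticChar_sq : complexQuadraticChar F ^ 2 = 1 := by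
  exact ((quadraticChar_isQuadratic F).comp _).sq_eq_one

theorem complexQuadraticChar_ne_one (h2 : (2 : F) ≠ 0) : complexQuadraticChar F ≠ 1 := by
  exact (MulChar.ringHomComp_ne_one_iff Int.cast_injective).2
    (quadraticChar_ne_one (ringChar_ne_two h2))

theorem eq_complexQuadraticChar (h2 : (2 : F) ≠ 0) {χ : MulChar F ℂ} (h1 : χ ≠ 1)
    (hχ : χ ^ 2 = 1) : χ = complexQuadraticChar F := by
  obtain ⟨γ, hγ, hext⟩ := MulChar.exists_forall_ext_of_apply_eq F
  have key : ∀ ψ : MulChar F ℂ, ψ ≠ 1 → ψ ^ 2 = 1 → ψ γ = -1 := fun ψ h h' ↦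
    (sq_eq_one_iff.1 (MulChar.apply_units_pow_eq_one h' γ)).resolve_left
      fun e ↦ h (hext _ _ (by rw [e, MulChar.one_apply_coe]))
  exact hext _ _ ((key χ h1 hχ).trans
    (key _ (complexQuadraticChar_ne_one h2) complexQuadraticChar_sq).symm)

theorem card_sq_eq (h2 : (2 : F) ≠ 0) (a : F) :
    (#{x : F | x ^ 2 = a} : ℂ) = 1 + complexQuadraticChar F a := by
  have h := quadraticChar_card_sqrts (ringChar_ne_two h2) a
  have h' : ((#{x : F | x ^ 2 = a} : ℤ) : ℂ) = ((quadraticChar F a + 1 : ℤ) : ℂ) := by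
    rw [← h]; congr 3; ext; simp
  rw [add_comm]
  have e : complexQuadraticChar F a = ((quadraticChar F a : ℤ) : ℂ) := by
    simp [complexQuadraticChar, MulChar.ringHomComp_apply]
  rw [e]
  exact_mod_cast h'

theorem complexQuadraticChar_sq_apply {a : F} (ha : a ≠ 0) :
    complexQuadraticChar F (a ^ 2) = 1 := by
  rw [map_pow]
  exact MulChar.apply_units_pow_eq_one complexQuadraticChar_sq (Units.mk0 a ha)

/-- `-3` is a square in a finite field having a cubic character. -/
theorem exists_sq_eq_neg_three {ω : MulChar F ℂ} (h1 : ω ≠ 1) (hω : ω ^ 3 = 1) :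
    ∃ s : F, s ^ 2 = -3 := by
  have hdvd : 3 ∣ Fintype.card Fˣ := by
    obtain ⟨γ, hγ, hext⟩ := MulChar.exists_forall_ext_of_apply_eq F
    have hw1 : ω γ ≠ 1 := fun e ↦ h1 (hext _ _ (by rw [e, MulChar.one_apply_coe]))
    have hord : orderOf (ω (γ : F)) = 3 :=
      orderOf_eq_prime (MulChar.apply_units_pow_eq_one hω γ) hw1 (hp := ⟨Nat.prime_three⟩)
    rw [← hord, orderOf_dvd_iff_pow_eq_one, ← map_pow, ← Units.val_pow_eq_pow_val, pow_card_eq_one,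
      Units.val_one, map_one]
  obtain ⟨z, hz⟩ := exists_prime_orderOf_dvd_card 3 hdvd (hp := ⟨Nat.prime_three⟩)
  have hz3 : (z : F) ^ 3 = 1 := by
    rw [← Units.val_pow_eq_pow_val, ← hz, pow_orderOf_eq_one, Units.val_one]
  have hz1 : (z : F) ≠ 1 := by
    intro h
    rw [Units.val_eq_one.1 h, orderOf_one] at hz
    lia
  have : ((z : F) - 1) * ((z : F) ^ 2 + z + 1) = 0 := by linear_combination hz3
  have := (mul_eq_zero.1 this).resolve_left (sub_ne_zero.2 hz1)
  exact ⟨2 * z + 1, by linear_combination 4 * this⟩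

theorem complexQuadraticChar_neg_three (h3 : (3 : F) ≠ 0) {ω : MulChar F ℂ} (h1 : ω ≠ 1)
    (hω : ω ^ 3 = 1) : complexQuadraticChar F (-3) = 1 := by
  obtain ⟨s, hs⟩ := exists_sq_eq_neg_three h1 hω
  rw [← hs]
  apply complexQuadraticChar_sq_apply
  rintro rfl
  apply h3
  linear_combination hs

theorem sum_units_add_inv (h2 : (2 : F) ≠ 0) (G : F → ℂ) :
    ∑ r : Fˣ, G (r + (r : F)⁻¹) = ∑ c : F, (1 + complexQuadraticChar F (c ^ 2 - 4)) * G c := by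
  classical
  rw [← sum_fiberwise (s := univ) (g := fun r : Fˣ ↦ (r : F) + (r : F)⁻¹)]
  refine sum_congr rfl fun c _ ↦ ?_
  rw [sum_congr rfl (g := fun _ ↦ G c), sum_const, nsmul_eq_mul]
  · rw [← card_sq_eq h2]
    congr 2
    refine card_bij (fun r _ ↦ 2 * (r : F) - c) ?_ ?_ ?_
    · intro r hr
      simp only [mem_filter, mem_univ, true_and] at hr ⊢
      rw [← hr]
      have := r.ne_zero
      field_simp
      ring
    · intro r _ s _ h
      exact Units.ext (mul_left_cancel₀ h2 (sub_left_injective h))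
    · intro d hd
      simp only [mem_filter, mem_univ, true_and] at hd
      have h0 : (c + d) / 2 ≠ 0 := by
        intro h
        have h : c + d = 0 := by simpa [h2] using h
        have : (2 : F) ^ 2 = 0 := by linear_combination hd - (d - c) * h
        exact h2 (pow_eq_zero_iff (two_ne_zero) |>.1 this)
      refine ⟨Units.mk0 _ h0, ?_, ?_⟩
      · simp only [mem_filter, mem_univ, true_and, Units.val_mk0]
        have h0' : c + d ≠ 0 := fun h ↦ h0 (by simp [h])
        field_simp
        linear_combination hd
      · simp only [Units.val_mk0]
        field_simp
        ring
  · intro x hx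
    rw [(mem_filter.1 hx).2]

theorem sum_cubic_nonsplit (h3 : complexQuadraticChar F (-3) = 1) (G : F → ℂ) :
    ∑ t : F, (1 - complexQuadraticChar F (t ^ 2 - 4)) * G (t ^ 3 - 3 * t) =
      ∑ c : F, (1 - complexQuadraticChar F (c ^ 2 - 4)) * G c := by
  classical
  set φ := complexQuadraticChar F
  set N : Finset F := {t : F | φ (t ^ 2 - 4) ≠ 1} with hN
  have hrestrict : ∀ K : F → ℂ, ∑ t : F, (1 - φ (t ^ 2 - 4)) * K t =
      ∑ t ∈ N, (1 - φ (t ^ 2 - 4)) * K t := by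
    intro K
    rw [hN, sum_filter_of_ne]
    intro t _ h e
    simp [e] at h
  rw [hrestrict (fun t ↦ G (t ^ 3 - 3 * t)), hrestrict G]
  have hne : ∀ t ∈ N, t ^ 2 - 1 ≠ 0 := by
    intro t ht h
    refine (mem_filter.1 ht).2 ?_
    rw [show t ^ 2 - 4 = -3 by linear_combination h, h3]
  have hval : ∀ t ∈ N, φ ((t ^ 3 - 3 * t) ^ 2 - 4) = φ (t ^ 2 - 4) := by
    intro t ht
    rw [show (t ^ 3 - 3 * t) ^ 2 - 4 = (t ^ 2 - 4) * (t ^ 2 - 1) ^ 2 by ring, map_mul,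
      complexQuadraticChar_sq_apply (hne t ht), mul_one]
  have hmaps : Set.MapsTo (fun t : F ↦ t ^ 3 - 3 * t) N N := by
    intro t ht
    have ht' := (mem_filter.1 (mem_coe.1 ht)).2
    simp only [hN, coe_filter, mem_univ, true_and, Set.mem_ofPred_eq]
    rwa [hval t (mem_coe.1 ht)]
  have hinj : Set.InjOn (fun t : F ↦ t ^ 3 - 3 * t) N := by
    intro t ht t' ht' h
    by_contra hne'
    have hq : t ^ 2 + t * t' + t' ^ 2 = 3 := by
      have : (t - t') * (t ^ 2 + t * t' + t' ^ 2 - 3) = 0 := by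
        simp only at h
        linear_combination h
      exact sub_eq_zero.1 ((mul_eq_zero.1 this).resolve_left (sub_ne_zero.2 hne'))
    have hd : (-3) * (t ^ 2 - 4) = (2 * t' + t) ^ 2 := by linear_combination -4 * hq
    by_cases h0 : 2 * t' + t = 0
    · refine hne t' (mem_coe.1 ht') ?_
      have e : (-3 : F) * (t' ^ 2 - 1) = 0 := by
        linear_combination -hq + (t - t') * h0
      refine (mul_eq_zero.1 e).resolve_left fun h ↦ ?_
      rw [h, MulChar.map_zero] at h3
      exact zero_ne_one h3
    · apply (mem_filter.1 (mem_coe.1 ht)).2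
      rw [← complexQuadraticChar_sq_apply h0, ← hd, map_mul, h3, one_mul]
  refine sum_nbij (fun t : F ↦ t ^ 3 - 3 * t) hmaps hinj
    (surjOn_of_injOn_of_card_le _ hmaps hinj le_rfl) fun t ht ↦ ?_
  rw [hval t ht]

/-- Summing over the values of `t ^ 3 - 3 * t`, the cubic Dickson polynomial. -/
theorem sum_cubic {ω : MulChar F ℂ} (h2 : (2 : F) ≠ 0) (h3 : (3 : F) ≠ 0) (h1 : ω ≠ 1)
    (hω : ω ^ 3 = 1) (G : F → ℂ) :
    ∑ t : F, G (t ^ 3 - 3 * t) = ∑ c : F, G c + ∑ r : Fˣ, ω r * G (r + (r : F)⁻¹) := by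
  have hA := sum_cubic_nonsplit (complexQuadraticChar_neg_three h3 h1 hω) G
  have hB := sum_units_add_inv h2 (fun t : F ↦ G (t ^ 3 - 3 * t))
  have hC := MulChar.sum_units_pow_prime Nat.prime_three h1 hω (fun r ↦ G (r + (r : F)⁻¹))
  have hD := sum_units_add_inv h2 G
  have hE : ∑ r : Fˣ, ω r ^ 2 * G (r + (r : F)⁻¹) = ∑ r : Fˣ, ω r * G (r + (r : F)⁻¹) := by
    rw [← Equiv.sum_comp (Equiv.inv Fˣ)]
    refine sum_congr rfl fun r _ ↦ ?_
    have : ω ((r⁻¹ : Fˣ) : F) ^ 2 = ω r := by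
      have e1 : ω ((r⁻¹ : Fˣ) : F) * ω r = 1 := by
        rw [← map_mul, ← Units.val_mul, inv_mul_cancel, Units.val_one, map_one]
      have e2 := MulChar.apply_units_pow_eq_one hω r⁻¹
      calc _ = ω ((r⁻¹ : Fˣ) : F) ^ 3 * ω r := by linear_combination (-ω ((r⁻¹ : Fˣ) : F) ^ 2) * e1
        _ = _ := by rw [e2, one_mul]
    simp only [Equiv.inv_apply, this]
    rw [Units.val_inv_eq_inv_val, inv_inv, add_comm]
  have hBC : ∑ r : Fˣ, G (((r : F) + (r : F)⁻¹) ^ 3 - 3 * ((r : F) + (r : F)⁻¹)) =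
      ∑ r : Fˣ, G ((r ^ 3 : Fˣ) + ((r ^ 3 : Fˣ) : F)⁻¹) := by
    refine sum_congr rfl fun r _ ↦ ?_
    congr 1
    have := r.ne_zero
    push_cast
    field_simp
    ring
  simp only [sum_range_succ, range_zero, sum_empty, pow_zero, pow_one, zero_add, add_mul, one_mul,
    sum_add_distrib, sub_mul, sum_sub_distrib] at hA hB hC hD
  linear_combination (hA + hBC - hB + hC + hD + hE) / 2

theorem sum_comp_sq_s10 (h2 : (2 : F) ≠ 0) (G : F → ℂ) :
    ∑ d : F, G (d ^ 2) = ∑ u : F, (1 + complexQuadraticChar F u) * G u := by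
  rw [← sum_fiberwise (s := univ) (g := fun d : F ↦ d ^ 2)]
  refine sum_congr rfl fun u _ ↦ ?_
  rw [← card_sq_eq h2, sum_congr rfl (g := fun _ ↦ G u), sum_const, nsmul_eq_mul]
  intro x hx
  rw [(mem_filter.1 hx).2]

theorem jacobiSum_self_s10 (h2 : (2 : F) ≠ 0) {χ : MulChar F ℂ} (hχ : χ ≠ 1) :
    jacobiSum χ χ = χ⁻¹ 4 * jacobiSum χ (complexQuadraticChar F) := by
  have h4 : (4 : F) ≠ 0 := by
    have : (4 : F) = 2 * 2 := by norm_num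
    rw [this]; exact mul_ne_zero h2 h2
  have hb : Function.Bijective fun d : F ↦ (1 + d) / 2 := by
    refine Finite.injective_iff_bijective.1 fun x y h ↦ ?_
    simpa [h2] using h
  calc jacobiSum χ χ = ∑ d : F, χ ((1 - d ^ 2) / 4) := by
        rw [jacobiSum, ← hb.sum_comp]
        refine sum_congr rfl fun d _ ↦ ?_
        rw [← map_mul]
        congr 1
        field_simp
        ring
    _ = ∑ u : F, (1 + complexQuadraticChar F u) * χ ((1 - u) / 4) :=
        sum_comp_sq_s10 h2 fun u ↦ χ ((1 - u) / 4)
    _ = ∑ u : F, χ⁻¹ 4 * χ (1 - u) + ∑ u : F, χ⁻¹ 4 * (complexQuadraticChar F u * χ (1 - u)) := by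
        rw [← sum_add_distrib]
        refine sum_congr rfl fun u _ ↦ ?_
        rw [div_eq_mul_inv, map_mul, MulChar.inv_apply']
        ring
    _ = _ := by
        have hs : ∑ u : F, χ (1 - u) = 0 :=
          (Equiv.sum_comp (Equiv.subLeft (1 : F)) (fun u ↦ χ u)).trans
            (MulChar.sum_eq_zero_of_ne_one hχ)
        rw [← mul_sum, ← mul_sum, jacobiSum_comm χ, jacobiSum, hs, mul_zero, zero_add]

theorem jacobiSum_mul_cubic {ω ρ : MulChar F ℂ} (h2 : (2 : F) ≠ 0) (h3 : (3 : F) ≠ 0) (h1 : ω ≠ 1)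
    (hω : ω ^ 3 = 1) (hρ : ρ ≠ 1) :
    jacobiSum (ρ * ω) (ρ * ω⁻¹) = ρ⁻¹ 27 * jacobiSum (ρ⁻¹ ^ 2) ρ⁻¹ := by
  have key := sum_cubic h2 h3 h1 hω fun c ↦ ρ⁻¹ (c + 2)
  have hs : ∑ c : F, ρ⁻¹ (c + 2) = 0 :=
    (Equiv.sum_comp (Equiv.addRight (2 : F)) (fun u ↦ ρ⁻¹ u)).trans
      (MulChar.sum_eq_zero_of_ne_one (inv_ne_one.2 hρ))
  rw [hs, zero_add] at key
  have hb : Function.Bijective fun y : F ↦ 1 - 3 * y := by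
    refine Finite.injective_iff_bijective.1 fun x y h ↦ ?_
    simpa [h3] using h
  have hL : ∑ t : F, ρ⁻¹ (t ^ 3 - 3 * t + 2) = ρ⁻¹ 27 * jacobiSum (ρ⁻¹ ^ 2) ρ⁻¹ := by
    rw [jacobiSum, ← hb.sum_comp, mul_sum]
    refine sum_congr rfl fun y _ ↦ ?_
    rw [MulChar.pow_apply' _ two_ne_zero, ← map_pow, ← map_mul, ← map_mul]
    congr 1
    ring
  have hne : ∀ r : Fˣ, ω r * ρ⁻¹ (r + (r : F)⁻¹ + 2) ≠ 0 → (1 : F) + r ≠ 0 := by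
    intro r hr e
    apply hr
    have hr1 : (r : F) = -1 := by linear_combination e
    rw [hr1, inv_neg, inv_one, show (-1 : F) + -1 + 2 = 0 by ring, MulChar.map_zero, mul_zero]
  rw [← hL, key, jacobiSum]
  symm
  refine sum_bij_ne_zero (fun r _ _ ↦ (r : F) / (1 + r)) (fun _ _ _ ↦ mem_univ _) ?_ ?_ ?_
  · intro r _ hr s _ hs h
    have hr' := hne r hr
    have hs' := hne s hs
    rw [div_eq_div_iff hr' hs'] at h
    exact Units.ext (by linear_combination h)
  · intro x _ hx
    have hx0 : x ≠ 0 := by rintro rfl; simp [MulChar.map_zero] at hx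
    have hx1 : 1 - x ≠ 0 := by intro e; simp [e, MulChar.map_zero] at hx
    refine ⟨Units.mk0 _ (div_ne_zero hx0 hx1), mem_univ _, ?_, ?_⟩
    · simp only [Units.val_mk0]
      refine mul_ne_zero (MulChar.apply_ne_zero_iff.2 (div_ne_zero hx0 hx1).isUnit)
        (MulChar.apply_ne_zero_iff.2 (IsUnit.mk0 _ ?_))
      have e : x / (1 - x) + (x / (1 - x))⁻¹ + 2 = (x * (1 - x))⁻¹ := by
        field_simp
        ring
      rw [e]
      exact inv_ne_zero (mul_ne_zero hx0 hx1)
    · simp only [Units.val_mk0]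
      field_simp
      ring
  · intro r _ hr
    have hr' := hne r hr
    have hr0 := r.ne_zero
    have e1 : 1 - (r : F) / (1 + r) = (1 + (r : F))⁻¹ := by
      field_simp
      ring
    have e2 : ((r : F) + (r : F)⁻¹ + 2)⁻¹ = (r / (1 + r)) * (1 + (r : F))⁻¹ := by
      rw [show (r : F) + (r : F)⁻¹ + 2 = (1 + (r : F)) ^ 2 / r by field_simp; ring]
      field_simp
    have e3 : (r : F) = r / (1 + (r : F)) * (1 + (r : F)) := by field_simp
    rw [e1, MulChar.inv_apply', e2, MulChar.mul_apply, MulChar.mul_apply, MulChar.inv_apply' ω,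
      inv_inv, map_mul]
    conv_lhs => enter [1]; rw [e3, map_mul]
    ring

/-- The Hasse-Davenport product formula for the exponent two. -/
theorem gaussSum_duplication (h2 : (2 : F) ≠ 0) (hψ : ψ.IsPrimitive) (χ : MulChar F ℂ) :
    gaussSum χ ψ * gaussSum (χ * complexQuadraticChar F) ψ =
      χ⁻¹ 4 * gaussSum (χ ^ 2) ψ * gaussSum (complexQuadraticChar F) ψ := by
  set φ := complexQuadraticChar F with hφ
  have h44 : (2 : F) ^ 2 = 4 := by norm_num
  by_cases h1 : χ = 1
  · subst h1
    rw [one_mul, inv_one, one_pow, MulChar.one_apply, one_mul]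
    rw [← h44]
    exact (pow_ne_zero 2 h2).isUnit
  have hφ2 : φ * φ = 1 := by rw [← pow_two]; exact complexQuadraticChar_sq
  by_cases hsq : χ ^ 2 = 1
  · have hχ : χ = φ := eq_complexQuadraticChar h2 h1 hsq
    rw [hχ, hφ2, pow_two, hφ2, MulChar.inv_apply', ← h44, ← inv_pow,
      complexQuadraticChar_sq_apply (inv_ne_zero h2)]
    ring
  have hχφ : χ * φ ≠ 1 := fun h ↦ hsq <| by
    rw [eq_inv_of_mul_eq_one_left h, inv_pow, complexQuadraticChar_sq, inv_one]
  have e1 := jacobiSum_mul_nontrivial (χ := χ) (φ := χ) (by rwa [← pow_two]) ψ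
  have e2 := jacobiSum_mul_nontrivial hχφ ψ
  rw [jacobiSum_self_s10 h2 h1, ← hφ, ← pow_two χ] at e1
  apply mul_left_cancel₀ (gaussSum_ne_zero_of_isPrimitive hψ χ)
  linear_combination -gaussSum (χ * φ) ψ * e1 + χ⁻¹ 4 * gaussSum (χ ^ 2) ψ * e2

/-- The Hasse-Davenport product formula for the exponent three. -/
theorem gaussSum_triplication {ω ρ : MulChar F ℂ} (h2 : (2 : F) ≠ 0) (h3 : (3 : F) ≠ 0)
    (h1 : ω ≠ 1) (hω : ω ^ 3 = 1) (hρ : ρ ≠ 1) (hψ : ψ.IsPrimitive) :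
    gaussSum (ρ * ω) ψ * gaussSum (ρ * ω⁻¹) ψ =
      ρ⁻¹ (-27) * gaussSum (ρ ^ 3) ψ * gaussSum ρ⁻¹ ψ := by
  have hJ := jacobiSum_mul_cubic h2 h3 h1 hω hρ
  have hωm : ω (-1) = 1 := by
    have : ω (-1) ^ 3 = 1 := by simpa using MulChar.apply_units_pow_eq_one hω (-1)
    linear_combination this - ω (-1) * apply_neg_one_sq ω
  have hρm : ρ⁻¹ (-27) = ρ (-1) * ρ⁻¹ 27 := by
    rw [show (-27 : F) = (-1) * 27 by norm_num, map_mul, MulChar.inv_apply' ρ (-1), inv_neg,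
      inv_one]
  have hprod : ρ * ω * (ρ * ω⁻¹) = ρ ^ 2 := by
    rw [mul_mul_mul_comm, mul_inv_cancel, mul_one, pow_two]
  have h127 : ∀ χ : MulChar F ℂ, χ ^ 3 = 1 → χ (-27) = 1 := by
    intro χ hχ
    have := MulChar.apply_units_pow_eq_one hχ (Units.mk0 (-3 : F) (neg_ne_zero.2 h3))
    rw [← map_pow] at this
    simpa [show (-3 : F) ^ 3 = -27 by norm_num] using this
  have hω2 : ω * ω = ω⁻¹ := eq_inv_of_mul_eq_one_left (by rw [← hω, pow_succ, pow_two])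
  by_cases hsq : ρ ^ 2 = 1
  · have hρi : ρ⁻¹ = ρ := inv_eq_of_mul_eq_one_right (by rw [← pow_two, hsq])
    have hinv : ρ * ω⁻¹ = (ρ * ω)⁻¹ := by rw [mul_inv, hρi]
    have hne : ρ * ω ≠ 1 := fun h ↦ h1 <| by
      have : ω = ρ := by rw [← hρi]; exact eq_inv_of_mul_eq_one_right h
      rw [← hω, this, pow_succ, hsq, one_mul]
    rw [hinv, jacobiSum_nontrivial_inv hne, inv_pow, hsq, inv_one,
      jacobiSum_one_nontrivial (inv_ne_one.2 hρ), MulChar.mul_apply, hωm] at hJ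
    rw [hinv, gaussSum_mul_gaussSum_inv_eq hne hψ, MulChar.mul_apply, hωm,
      show ρ ^ 3 = ρ by rw [pow_succ, hsq, one_mul], mul_assoc (ρ⁻¹ (-27)),
      gaussSum_mul_gaussSum_inv_eq hρ hψ, hρm]
    linear_combination (-(Fintype.card F : ℂ)) * hJ - ρ⁻¹ 27 * Fintype.card F * apply_neg_one_sq ρ
  by_cases hcu : ρ ^ 3 = 1
  · rw [hcu, h127 ρ⁻¹ (by rw [inv_pow, hcu, inv_one]), one_mul]
    rcases eq_one_or_of_pow_three h1 hω hcu with h | rfl | rfl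
    · exact absurd h hρ
    · rw [mul_inv_cancel, hω2, mul_comm]
    · rw [inv_mul_cancel, ← mul_inv, hω2]
  have e1 := jacobiSum_mul_nontrivial (χ := ρ * ω) (φ := ρ * ω⁻¹) (by rwa [hprod]) ψ
  have e2 := jacobiSum_mul_nontrivial (χ := ρ⁻¹ ^ 2) (φ := ρ⁻¹)
    (by rw [← pow_succ, inv_pow]; exact inv_ne_one.2 hcu) ψ
  have e3 := gaussSum_mul_gaussSum_inv_eq hsq hψ
  have e4 := gaussSum_mul_gaussSum_inv_eq hcu hψ
  rw [hprod, hJ] at e1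
  rw [← pow_succ, inv_pow, inv_pow] at e2
  rw [inv_pow] at e1
  rw [MulChar.pow_apply' _ two_ne_zero, apply_neg_one_sq, one_mul] at e3
  rw [MulChar.pow_apply' _ three_ne_zero] at e4
  have hq : (Fintype.card F : ℂ) ≠ 0 := by simp
  have hm3 : ρ (-1) ^ 3 = ρ (-1) := by rw [pow_succ, apply_neg_one_sq, one_mul]
  rw [hm3] at e4
  apply mul_left_cancel₀ hq
  rw [hρm]
  linear_combination (-(Fintype.card F : ℂ)) * e1
    - ρ⁻¹ 27 * gaussSum (ρ ^ 2) ψ * jacobiSum (ρ ^ 2)⁻¹ ρ⁻¹ * ρ (-1) * e4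
    + ρ⁻¹ 27 * ρ (-1) * gaussSum (ρ ^ 2) ψ * gaussSum (ρ ^ 3) ψ * e2
    + ρ⁻¹ 27 * ρ (-1) * gaussSum (ρ ^ 3) ψ * gaussSum ρ⁻¹ ψ * e3
    - ρ⁻¹ 27 * gaussSum (ρ ^ 2) ψ * jacobiSum (ρ ^ 2)⁻¹ ρ⁻¹ * Fintype.card F * apply_neg_one_sq ρ

theorem sum_eq_add_sum_units (f : F → ℂ) : ∑ x : F, f x = f 0 + ∑ x : Fˣ, f x := by
  rw [← add_sum_erase univ f (mem_univ 0)]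
  congr 1
  symm
  refine sum_bij (fun x _ ↦ (x : F)) (fun x _ ↦ by simp) (fun _ _ _ _ h ↦ Units.ext h)
    (fun x hx ↦ ⟨Units.mk0 x (by simpa using hx), mem_univ _, rfl⟩) fun _ _ ↦ rfl

theorem gaussSum_eq_sum_units (χ : MulChar F ℂ) :
    gaussSum χ ψ = ∑ u : Fˣ, χ u * ψ u := by
  rw [gaussSum, sum_eq_add_sum_units, MulChar.map_zero, zero_mul, zero_add]

theorem sum_mulChar_apply [Fintype (MulChar F ℂ)] (k : Fˣ) :
    ∑ ρ : MulChar F ℂ, ρ k = if k = 1 then (Fintype.card F : ℂ) - 1 else 0 := by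
  split_ifs with hk
  · simp only [hk, Units.val_one, map_one, sum_const, card_univ, nsmul_eq_mul, mul_one]
    rw [← Nat.card_eq_fintype_card, MulChar.card_eq_card_units_of_hasEnoughRootsOfUnity,
      Nat.card_eq_fintype_card, Fintype.card_units, Nat.cast_sub Fintype.card_pos, Nat.cast_one]
  · obtain ⟨η, hη⟩ := MulChar.exists_apply_ne_one_of_hasEnoughRootsOfUnity F ℂ
      (a := (k : F)) (by simpa using hk)
    have h : η k * ∑ ρ : MulChar F ℂ, ρ k = ∑ ρ : MulChar F ℂ, ρ k := by
      rw [mul_sum, ← Equiv.sum_comp (Equiv.mulLeft η) fun ρ : MulChar F ℂ ↦ ρ k]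
      rfl
    exact (mul_eq_zero.1 (by linear_combination h :
      (η k - 1) * ∑ ρ : MulChar F ℂ, ρ k = 0)).resolve_left (sub_ne_zero.2 hη)

theorem sum_mulChar_mul_gaussSum [Fintype (MulChar F ℂ)] (χ : MulChar F ℂ) (k : Fˣ) :
    ∑ ρ : MulChar F ℂ, ρ k * gaussSum (χ * (ρ⁻¹) ^ 2) ψ * gaussSum (ρ ^ 3) ψ * gaussSum ρ⁻¹ ψ =
      ((Fintype.card F : ℂ) - 1) * ∑ u : Fˣ, ∑ v : Fˣ,
        χ u * (ψ u * ψ v * ψ (k * v ^ 3 * (u⁻¹) ^ 2 : Fˣ)) := by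
  have hinv : ∀ (ρ : MulChar F ℂ) (u : Fˣ), ρ⁻¹ (u : F) = ρ (u⁻¹ : Fˣ) := fun ρ u ↦ by
    rw [MulChar.inv_apply', Units.val_inv_eq_inv_val]
  have h : ∀ ρ : MulChar F ℂ,
      ρ k * gaussSum (χ * (ρ⁻¹) ^ 2) ψ * gaussSum (ρ ^ 3) ψ * gaussSum ρ⁻¹ ψ =
        ∑ u : Fˣ, ∑ v : Fˣ, ∑ w : Fˣ,
          χ u * (ψ u * ψ v * ψ w) * ρ (k * v ^ 3 * (u⁻¹) ^ 2 * w⁻¹ : Fˣ) := by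
    intro ρ
    have hterm : ∀ u v w : Fˣ,
        χ u * (ψ u * ψ v * ψ w) * ρ (k * v ^ 3 * (u⁻¹) ^ 2 * w⁻¹ : Fˣ) =
          ρ k * ((χ * (ρ⁻¹) ^ 2) u * ψ u) * ((ρ ^ 3) v * ψ v) * (ρ⁻¹ w * ψ w) := by
      intro u v w
      rw [MulChar.mul_apply, MulChar.pow_apply_coe, MulChar.pow_apply_coe, hinv, hinv]
      push_cast
      simp only [map_mul, map_pow]
      ring
    simp_rw [hterm, ← mul_sum, ← sum_mul, ← mul_sum, ← gaussSum_eq_sum_units,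
      ← sum_mul, ← mul_sum, ← gaussSum_eq_sum_units]
  simp_rw [h]
  rw [sum_comm, mul_sum]
  refine sum_congr rfl fun u _ ↦ ?_
  rw [sum_comm, mul_sum]
  refine sum_congr rfl fun v _ ↦ ?_
  rw [sum_comm]
  simp_rw [← mul_sum, sum_mulChar_apply, mul_inv_eq_one]
  simp only [mul_ite, mul_zero, sum_ite_eq, mem_univ, if_true]
  ring

theorem complexQuadraticChar_mul_gaussSum (h2 : (2 : F) ≠ 0) (m : F) :
    complexQuadraticChar F m * gaussSum (complexQuadraticChar F) ψ =
      ∑ t : Fˣ, complexQuadraticChar F t * ψ (t * m) := by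
  set φ := complexQuadraticChar F
  by_cases hm : m = 0
  · have := gaussSum_eq_sum_units (ψ := (1 : AddChar F ℂ)) φ
    rw [gaussSum] at this
    simp only [AddChar.one_apply, mul_one] at this
    rw [hm, MulChar.map_zero, zero_mul]
    simp only [mul_zero, AddChar.map_zero_eq_one, mul_one]
    rw [← this, MulChar.sum_eq_zero_of_ne_one (complexQuadraticChar_ne_one h2)]
  · have h := gaussSum_mulShift φ ψ (Units.mk0 m hm)
    rw [Units.val_mk0] at h
    have hsq : φ m * φ m = 1 := by
      rw [← map_mul, ← pow_two, complexQuadraticChar_sq_apply hm]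
    rw [← h, ← mul_assoc, hsq, one_mul, gaussSum_eq_sum_units]
    refine sum_congr rfl fun t _ ↦ ?_
    rw [AddChar.mulShift_apply, mul_comm m]

/-- The character sum attached to a Weierstrass equation, in terms of products of Gauss sums. -/
theorem gaussSum_mul_sum_weierstrass [Fintype (MulChar F ℂ)] (h2 : (2 : F) ≠ 0) (a b : Fˣ) :
    ((Fintype.card F : ℂ) - 1) * gaussSum (complexQuadraticChar F) ψ *
        ∑ x : F, complexQuadraticChar F (x ^ 3 + a * x + b) =
      complexQuadraticChar F b * (((Fintype.card F : ℂ) - 1) * gaussSum (complexQuadraticChar F) ψ +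
        ∑ ρ : MulChar F ℂ, ρ (b ^ 2 * (a⁻¹) ^ 3 : Fˣ) *
          gaussSum (complexQuadraticChar F * (ρ⁻¹) ^ 2) ψ * gaussSum (ρ ^ 3) ψ *
            gaussSum ρ⁻¹ ψ) := by
  set φ := complexQuadraticChar F with hφ
  have hφb : φ b * φ b = 1 := by
    rw [← map_mul, ← pow_two, complexQuadraticChar_sq_apply b.ne_zero]
  rw [sum_mulChar_mul_gaussSum, sum_eq_add_sum_units]
  have h : gaussSum φ ψ * ∑ x : Fˣ, φ ((x : F) ^ 3 + a * x + b) =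
      φ b * ∑ u : Fˣ, ∑ v : Fˣ,
        φ u * (ψ u * ψ v * ψ (b ^ 2 * (a⁻¹) ^ 3 * v ^ 3 * (u⁻¹) ^ 2 : Fˣ)) := by
    rw [mul_sum]
    simp_rw [mul_comm (gaussSum φ ψ), hφ, complexQuadraticChar_mul_gaussSum h2, ← hφ]
    rw [sum_comm, ← Equiv.sum_comp (Equiv.mulLeft b) fun u : Fˣ ↦ ∑ v : Fˣ,
        φ u * (ψ u * ψ v * ψ (b ^ 2 * (a⁻¹) ^ 3 * v ^ 3 * (u⁻¹) ^ 2 : Fˣ)), mul_sum]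
    refine sum_congr rfl fun t _ ↦ ?_
    rw [Equiv.coe_mulLeft, ← Equiv.sum_comp (Equiv.mulLeft (a * t)) fun v : Fˣ ↦ φ (b * t : Fˣ) *
        (ψ (b * t : Fˣ) * ψ v * ψ (b ^ 2 * (a⁻¹) ^ 3 * v ^ 3 * ((b * t)⁻¹) ^ 2 : Fˣ)), mul_sum]
    refine sum_congr rfl fun x _ ↦ ?_
    have e : b ^ 2 * a⁻¹ ^ 3 * (a * t * x) ^ 3 * (b * t)⁻¹ ^ 2 = t * x ^ 3 := by
      ext
      have := a.ne_zero
      have := b.ne_zero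
      have := t.ne_zero
      push_cast
      field_simp
    simp only [Equiv.coe_mulLeft, e]
    rw [← AddChar.map_add_eq_mul, ← AddChar.map_add_eq_mul]
    push_cast
    rw [map_mul φ, ← mul_assoc, ← mul_assoc, hφb, one_mul]
    congr 2
    ring
  rw [show (0 : F) ^ 3 + a * 0 + b = b by ring]
  linear_combination ((Fintype.card F : ℂ) - 1) * h

open Classical in
theorem card_cube_mul_binomC_mul_binomC {A : MulChar F ℂ} (h2 : (2 : F) ≠ 0) (h3 : (3 : F) ≠ 0)
    (hA4 : A ^ 4 ≠ 1) (hA6 : A ^ 6 = complexQuadraticChar F) (hψ : ψ.IsPrimitive)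
    (ρ : MulChar F ℂ) :
    (Fintype.card F : ℂ) ^ 3 * (binomC F (A * (A ^ 3 * ρ)) (A ^ 3 * ρ) *
        binomC F (A ^ 5 * (A ^ 3 * ρ)) (A ^ 6 * (A ^ 3 * ρ))) =
      A (-1) * (A ^ 3 * ρ) 4 * gaussSum (complexQuadraticChar F) ψ *
        gaussSum (complexQuadraticChar F * (ρ⁻¹) ^ 2) ψ *
        (ρ⁻¹ (-27) * gaussSum (ρ ^ 3) ψ * gaussSum ρ⁻¹ ψ +
          if ρ = 1 then (Fintype.card F : ℂ) - 1 else 0) := by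
  set φ := complexQuadraticChar F with hφ
  have hφ2 : φ ^ 2 = 1 := complexQuadraticChar_sq
  have hφi : φ⁻¹ = φ := inv_eq_of_mul_eq_one_right (by rw [← pow_two, hφ2])
  have hA12 : A ^ 12 = 1 := by rw [show 12 = 6 * 2 from rfl, pow_mul, hA6, hφ2]
  have hA1 : A ≠ 1 := fun h ↦ hA4 (by rw [h, one_pow])
  have hq : (Fintype.card F : ℂ) ≠ 0 := by simp
  have hω : (A ^ 4) ^ 3 = 1 := by rw [← pow_mul, hA12]
  have hω8 : A ^ 8 = (A ^ 4)⁻¹ := eq_inv_of_mul_eq_one_left (by rw [← pow_add, hA12])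
  have htrip : gaussSum (ρ * A ^ 4) ψ * gaussSum (ρ * (A ^ 4)⁻¹) ψ =
      ρ⁻¹ (-27) * gaussSum (ρ ^ 3) ψ * gaussSum ρ⁻¹ ψ +
        if ρ = 1 then (Fintype.card F : ℂ) - 1 else 0 := by
    split_ifs with hρ
    · have h27 : IsUnit (-27 : F) := by
        rw [show (-27 : F) = (-3) ^ 3 by norm_num]
        exact (pow_ne_zero 3 (neg_ne_zero.2 h3)).isUnit
      have hω1 : (A ^ 4) (-1) = 1 := by
        rw [MulChar.pow_apply' _ four_ne_zero, show 4 = 2 * 2 from rfl, pow_mul, apply_neg_one_sq,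
          one_pow]
      rw [hρ, one_mul, one_mul, gaussSum_mul_gaussSum_inv_eq hA4 hψ, hω1, inv_one, one_pow,
        gaussSum_one_left_of_isPrimitive hψ, MulChar.one_apply h27]
      ring
    · rw [add_zero, gaussSum_triplication h2 h3 hA4 hω hρ hψ]
  set χ := A ^ 3 * ρ with hχ
  have e1 : A * χ = ρ * A ^ 4 := by rw [hχ, ← mul_assoc, ← pow_succ', mul_comm]
  have e2 : A ^ 5 * χ = ρ * (A ^ 4)⁻¹ := by rw [hχ, ← mul_assoc, ← pow_add, ← hω8, mul_comm]
  have e3 : (A ^ 6 * χ)⁻¹ = χ⁻¹ * φ := by rw [hA6, mul_inv_rev, hφi]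
  have e4 : χ⁻¹ ^ 2 = φ * ρ⁻¹ ^ 2 := by
    rw [hχ, mul_inv, mul_pow, ← hφi, ← hA6, inv_pow, ← pow_mul]
  have hJ1 := jacobiSum_mul_nontrivial (χ := A * χ) (φ := χ⁻¹) (by simpa using hA1) ψ
  rw [mul_inv_cancel_right] at hJ1
  have e5 : A ^ 5 * χ * (A ^ 6 * χ)⁻¹ = A⁻¹ := by
    rw [pow_succ A 5]
    group
  have hJ2 := jacobiSum_mul_nontrivial (χ := A ^ 5 * χ) (φ := (A ^ 6 * χ)⁻¹)
    (by rw [e5]; exact inv_ne_one.2 hA1) ψ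
  rw [e5] at hJ2
  have hdup := gaussSum_duplication h2 hψ χ⁻¹
  rw [inv_inv, ← hφ, ← e3, e4] at hdup
  have hAA := gaussSum_mul_gaussSum_inv_eq hA1 hψ
  have hφ1 : φ (-1) = 1 := by
    rw [← hA6, MulChar.pow_apply' _ (by norm_num), show 6 = 2 * 3 from rfl, pow_mul,
      apply_neg_one_sq, one_pow]
  have hbin : (Fintype.card F : ℂ) ^ 3 * (binomC F (A * χ) χ * binomC F (A ^ 5 * χ) (A ^ 6 * χ)) =
      Fintype.card F * (jacobiSum (A * χ) χ⁻¹ * jacobiSum (A ^ 5 * χ) (A ^ 6 * χ)⁻¹) := by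
    have h := apply_neg_one_sq χ
    rw [binomC, binomC, MulChar.mul_apply (A ^ 6), hA6, hφ1]
    field_simp
    linear_combination jacobiSum (A * χ) χ⁻¹ * jacobiSum (A ^ 5 * χ) (φ * χ)⁻¹ * h
  rw [hbin, ← htrip]
  rw [e1] at hJ1 ⊢
  rw [e2] at hJ2 ⊢
  have hAm := apply_neg_one_sq A
  linear_combination (-(Fintype.card F : ℂ) * jacobiSum (ρ * A ^ 4) χ⁻¹ *
      jacobiSum (ρ * (A ^ 4)⁻¹) (A ^ 6 * χ)⁻¹) * hAm
    - A (-1) * jacobiSum (ρ * A ^ 4) χ⁻¹ * jacobiSum (ρ * (A ^ 4)⁻¹) (A ^ 6 * χ)⁻¹ * hAA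
    + A (-1) * gaussSum A⁻¹ ψ * jacobiSum (ρ * (A ^ 4)⁻¹) (A ^ 6 * χ)⁻¹ * hJ1
    + A (-1) * gaussSum (ρ * A ^ 4) ψ * gaussSum χ⁻¹ ψ * hJ2
    + A (-1) * gaussSum (ρ * A ^ 4) ψ * gaussSum (ρ * (A ^ 4)⁻¹) ψ * hdup

/-- The character sum attached to a Weierstrass equation, as a hypergeometric character sum. -/
theorem card_sq_mul_sum_binomC [Fintype (MulChar F ℂ)] {A : MulChar F ℂ} (h2 : (2 : F) ≠ 0)
    (h3 : (3 : F) ≠ 0) (hA4 : A ^ 4 ≠ 1) (hA6 : A ^ 6 = complexQuadraticChar F) {a b : F}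
    (ha : a ≠ 0) (hb : b ≠ 0) :
    (A ^ 3) (a ^ 3 / 27) * (Fintype.card F : ℂ) ^ 2 *
        ∑ χ : MulChar F ℂ, binomC F (A * χ) χ * binomC F (A ^ 5 * χ) (A ^ 6 * χ) *
          χ (-27 * b ^ 2 / (4 * a ^ 3)) =
      ((Fintype.card F : ℂ) - 1) * ∑ x : F, complexQuadraticChar F (x ^ 3 + a * x + b) := by
  classical
  obtain ⟨ψ, hψ⟩ := exists_addChar_isPrimitive (F := F)
  have hW := gaussSum_mul_sum_weierstrass (ψ := ψ) h2 (Units.mk0 a ha) (Units.mk0 b hb)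
  have hD := card_cube_mul_binomC_mul_binomC h2 h3 hA4 hA6 hψ
  set φ := complexQuadraticChar F with hφ
  have hq : (Fintype.card F : ℂ) ≠ 0 := by simp
  have h4 : (4 : F) ≠ 0 := by
    rw [show (4 : F) = 2 ^ 2 by norm_num]
    exact pow_ne_zero 2 h2
  have h27 : (27 : F) ≠ 0 := by
    rw [show (27 : F) = 3 ^ 3 by norm_num]
    exact pow_ne_zero 3 h3
  have hφb : φ b * φ b = 1 := by
    rw [← map_mul, ← pow_two, complexQuadraticChar_sq_apply hb]
  have hφ1 : φ (-1) = 1 := by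
    rw [← hA6, MulChar.pow_apply' _ (by norm_num), show 6 = 2 * 3 from rfl, pow_mul,
      apply_neg_one_sq, one_pow]
  have hgg : gaussSum φ ψ * gaussSum φ ψ = Fintype.card F := by
    have h := gaussSum_mul_gaussSum_inv_eq (complexQuadraticChar_ne_one h2) hψ
    rwa [← hφ, inv_eq_of_mul_eq_one_right (by rw [← pow_two, hφ, complexQuadraticChar_sq]), hφ1,
      one_mul] at h
  have hκ : (A ^ 3) (a ^ 3 / 27) * (A (-1) * (A ^ 3) (-27 * b ^ 2 / a ^ 3)) = φ b := by
    rw [mul_left_comm, ← map_mul,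
      show a ^ 3 / 27 * (-27 * b ^ 2 / a ^ 3) = -1 * b ^ 2 by field_simp,
      map_mul, map_pow, MulChar.pow_apply' _ three_ne_zero, MulChar.pow_apply' _ three_ne_zero,
      ← hA6, MulChar.pow_apply' _ (by norm_num)]
    linear_combination (A b ^ 6) * (A (-1) ^ 2 + 1) * apply_neg_one_sq A
  have hterm : ∀ ρ : MulChar F ℂ, (A ^ 3) (a ^ 3 / 27) * (Fintype.card F : ℂ) ^ 3 *
      (binomC F (A * (A ^ 3 * ρ)) (A ^ 3 * ρ) *
        binomC F (A ^ 5 * (A ^ 3 * ρ)) (A ^ 6 * (A ^ 3 * ρ)) *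
        (A ^ 3 * ρ) (-27 * b ^ 2 / (4 * a ^ 3))) =
      φ b * gaussSum φ ψ * (ρ (b ^ 2 * (a⁻¹) ^ 3) * gaussSum (φ * (ρ⁻¹) ^ 2) ψ *
        gaussSum (ρ ^ 3) ψ * gaussSum ρ⁻¹ ψ +
          if ρ = 1 then ((Fintype.card F : ℂ) - 1) * gaussSum φ ψ else 0) := by
    intro ρ
    have e1 : (A ^ 3 * ρ) 4 * (A ^ 3 * ρ) (-27 * b ^ 2 / (4 * a ^ 3)) =
        (A ^ 3) (-27 * b ^ 2 / a ^ 3) * (ρ (-27) * ρ (b ^ 2 * a⁻¹ ^ 3)) := by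
      rw [← map_mul, ← map_mul ρ, MulChar.mul_apply]
      congr 2 <;> field_simp
    have e2 : ρ (-27) * ρ⁻¹ (-27) = 1 := by
      rw [MulChar.inv_apply', ← map_mul, mul_inv_cancel₀ (neg_ne_zero.2 h27), map_one]
    have e3 : (ρ (-27) * ρ (b ^ 2 * a⁻¹ ^ 3) * gaussSum (φ * (ρ⁻¹) ^ 2) ψ *
        if ρ = 1 then (Fintype.card F : ℂ) - 1 else 0) =
          if ρ = 1 then ((Fintype.card F : ℂ) - 1) * gaussSum φ ψ else 0 := by
      split_ifs with hρ
      · rw [hρ, inv_one, one_pow, mul_one, MulChar.one_apply (neg_ne_zero.2 h27).isUnit,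
          MulChar.one_apply (mul_ne_zero (pow_ne_zero 2 hb)
            (pow_ne_zero 3 (inv_ne_zero ha))).isUnit]
        ring
      · rw [mul_zero]
    rw [← e3]
    set δ : ℂ := if ρ = 1 then (Fintype.card F : ℂ) - 1 else 0
    linear_combination (A ^ 3) (a ^ 3 / 27) * (A ^ 3 * ρ) (-27 * b ^ 2 / (4 * a ^ 3)) * hD ρ
      + (A ^ 3) (a ^ 3 / 27) * A (-1) * gaussSum φ ψ * gaussSum (φ * (ρ⁻¹) ^ 2) ψ *
        (ρ⁻¹ (-27) * gaussSum (ρ ^ 3) ψ * gaussSum ρ⁻¹ ψ + δ) * e1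
      + (ρ (-27) * ρ (b ^ 2 * a⁻¹ ^ 3)) * gaussSum φ ψ * gaussSum (φ * (ρ⁻¹) ^ 2) ψ *
        (ρ⁻¹ (-27) * gaussSum (ρ ^ 3) ψ * gaussSum ρ⁻¹ ψ + δ) * hκ
      + φ b * ρ (b ^ 2 * a⁻¹ ^ 3) * gaussSum φ ψ * gaussSum (φ * (ρ⁻¹) ^ 2) ψ *
        (gaussSum (ρ ^ 3) ψ * gaussSum ρ⁻¹ ψ) * e2
  apply mul_left_cancel₀ hq
  rw [← Equiv.sum_comp (Equiv.mulLeft (A ^ 3)) fun χ : MulChar F ℂ ↦ binomC F (A * χ) χ *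
    binomC F (A ^ 5 * χ) (A ^ 6 * χ) * χ (-27 * b ^ 2 / (4 * a ^ 3))]
  calc _ = ∑ ρ : MulChar F ℂ, (A ^ 3) (a ^ 3 / 27) * (Fintype.card F : ℂ) ^ 3 *
      (binomC F (A * (A ^ 3 * ρ)) (A ^ 3 * ρ) *
        binomC F (A ^ 5 * (A ^ 3 * ρ)) (A ^ 6 * (A ^ 3 * ρ)) *
        (A ^ 3 * ρ) (-27 * b ^ 2 / (4 * a ^ 3))) := by
        rw [← mul_sum]
        simp only [Equiv.coe_mulLeft]
        ring
    _ = _ := by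
        simp_rw [hterm]
        rw [← mul_sum, sum_add_distrib, sum_ite_eq' univ (1 : MulChar F ℂ), if_pos (mem_univ _)]
        push_cast [Units.val_mk0] at hW
        linear_combination (-gaussSum φ ψ) * hW
          + ((Fintype.card F : ℂ) - 1) * (∑ x : F, φ (x ^ 3 + a * x + b)) * hgg

theorem natCard_weierstrass (h2 : (2 : F) ≠ 0) (a b : F) :
    (Nat.card {xy : F × F // xy.2 ^ 2 = xy.1 ^ 3 + a * xy.1 + b} : ℂ) =
      Fintype.card F + ∑ x : F, complexQuadraticChar F (x ^ 3 + a * x + b) := by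
  rw [Nat.card_eq_fintype_card, Fintype.card_subtype, card_filter, Fintype.sum_prod_type]
  simp_rw [← card_filter]
  push_cast
  simp_rw [card_sq_eq h2, sum_add_distrib]
  simp

theorem bijOn_pow_range_mulChar [Fintype (MulChar F ℂ)] {T : MulChar F ℂ}
    (hT : ∀ χ : MulChar F ℂ, ∃ n : ℕ, χ = T ^ n) :
    Set.BijOn (fun m : ℕ ↦ T ^ m) (range (Fintype.card F - 1)) (univ : Finset (MulChar F ℂ)) := by
  have hcard : Fintype.card (MulChar F ℂ) = Fintype.card F - 1 := by
    rw [← Nat.card_eq_fintype_card, MulChar.card_eq_card_units_of_hasEnoughRootsOfUnity,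
      Nat.card_eq_fintype_card, Fintype.card_units]
  have hmaps : Set.MapsTo (fun m : ℕ ↦ T ^ m) (range (Fintype.card F - 1))
      (univ : Finset (MulChar F ℂ)) := fun m _ ↦ by simp
  have hsurj : Set.SurjOn (fun m : ℕ ↦ T ^ m) (range (Fintype.card F - 1))
      (univ : Finset (MulChar F ℂ)) := by
    intro χ _
    obtain ⟨n, rfl⟩ := hT χ
    have h1 := MulChar.pow_card_eq_one T
    rw [Fintype.card_units] at h1
    refine ⟨n % (Fintype.card F - 1), ?_, ?_⟩
    · rw [mem_coe, mem_range]
      exact Nat.mod_lt _ (Nat.sub_pos_of_lt Fintype.one_lt_card)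
    · exact (pow_eq_pow_mod n h1).symm
  exact ⟨hmaps, injOn_of_surjOn_of_card_le _ hmaps hsurj (by rw [card_range, card_univ, hcard]),
    hsurj⟩

end CharacterSums

theorem stmt_10 (p e : ℕ) [Fact p.Prime] (hp : 3 < p) (he : 0 < e)
    (F : Type) [Field F] [Fintype F]
    (hq : Fintype.card F = p ^ e) (h12 : Fintype.card F % 12 = 1)
    (a b : F) (ha : a ≠ 0) (hb : b ≠ 0) (hΔ : 4 * a ^ 3 + 27 * b ^ 2 ≠ 0)
    (T : MulChar F ℂ) (hT : ∀ χ : MulChar F ℂ, ∃ n : ℕ, χ = T ^ n) :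
    (Fintype.card F : ℂ) + 1 -
        ((Nat.card {xy : F × F // xy.2 ^ 2 = xy.1 ^ 3 + a * xy.1 + b} + 1 : ℕ) : ℂ) =
      -(Fintype.card F : ℂ) * (T ^ ((Fintype.card F - 1) / 4)) (a ^ 3 / 27) *
        hypF21 F T (T ^ ((Fintype.card F - 1) / 12)) (T ^ (5 * ((Fintype.card F - 1) / 12)))
          (T ^ ((Fintype.card F - 1) / 2)) (-27 * b ^ 2 / (4 * a ^ 3)) := by
  classical
  have : Fintype (MulChar F ℂ) := Fintype.ofFinite _
  have hbij := bijOn_pow_range_mulChar hT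
  set q := Fintype.card F with hqdef
  obtain ⟨n, hn⟩ : ∃ n, q = 12 * n + 1 := ⟨q / 12, by lia⟩
  have hq1 : 1 < q := Fintype.one_lt_card
  have hn0 : 0 < n := by lia
  have e0 : q - 1 = 12 * n := by lia
  have e1 : 12 * n / 4 = n * 3 := by lia
  have e2 : 12 * n / 12 = n := by lia
  have e3 : 12 * n / 2 = n * 6 := by lia
  have hcast : (12 : F) * n + 1 = 0 := by
    have h := FiniteField.cast_card_eq_zero F
    rw [← hqdef, hn] at h
    exact_mod_cast h
  have h2 : (2 : F) ≠ 0 := fun h ↦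
    one_ne_zero (by linear_combination hcast - 6 * n * h : (1 : F) = 0)
  have h3 : (3 : F) ≠ 0 := fun h ↦
    one_ne_zero (by linear_combination hcast - 4 * n * h : (1 : F) = 0)
  have hpow : ∀ k, 0 < k → k < 12 → (T ^ n) ^ k ≠ 1 := by
    intro k h0 h12 h
    have h' : n * k = 0 := hbij.injOn (by simp [e0]; nlinarith) (by simp [e0]; lia)
      (by simp [pow_mul, h])
    have := Nat.mul_pos hn0 h0
    lia
  have hT12 : ((T ^ n) ^ 6) ^ 2 = 1 := by
    have h1 := MulChar.pow_card_eq_one T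
    rw [Fintype.card_units, ← hqdef, e0] at h1
    rw [← pow_mul, ← pow_mul, ← h1]
    congr 1
    ring
  have hA6 := eq_complexQuadraticChar h2 (hpow 6 (by norm_num) (by norm_num)) hT12
  have hmain := card_sq_mul_sum_binomC h2 h3 (hpow 4 (by norm_num) (by norm_num)) hA6 ha hb
  rw [hypF21, ← hqdef, e0, e1, e2, e3, mul_comm 5 n, pow_mul, pow_mul, pow_mul]
  have hsum := sum_nbij (fun m : ℕ ↦ T ^ m) (f := fun m ↦ binomC F (T ^ n * T ^ m) (T ^ m) *
      binomC F ((T ^ n) ^ 5 * T ^ m) ((T ^ n) ^ 6 * T ^ m) * (T ^ m) (-27 * b ^ 2 / (4 * a ^ 3)))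
    (g := fun χ ↦ binomC F (T ^ n * χ) χ * binomC F ((T ^ n) ^ 5 * χ) ((T ^ n) ^ 6 * χ) *
      χ (-27 * b ^ 2 / (4 * a ^ 3))) hbij.mapsTo hbij.injOn hbij.surjOn fun _ _ ↦ rfl
  rw [← e0, hsum]
  have hq0 : (q : ℂ) - 1 ≠ 0 := by
    rw [sub_ne_zero]
    exact_mod_cast hq1.ne'
  push_cast
  rw [natCard_weierstrass h2, ← hqdef]
  rw [← hqdef] at hmain
  linear_combination -eq_div_of_mul_eq hq0 ((mul_comm _ _).trans hmain.symm)
end
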